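/- arXiv:math/0211324 — 2 statements merged into one kernel-verified Lean document; each statement's English description precedes it below -/
import Mathlib

section
/- Assume f is proper and regular with d_m ≥ 2, and let K := {z ∈ ℂ^k : the orbit (f^n(z))_{n≥0} is bounded}. Then ℂ^k is the disjoint union of K, U_1, …, U_m (in particular K = K_m); K is compact; for each 1 ≤ i ≤ m the set U_1 ∪ ⋯ ∪ U_i is open in ℂ^k; and for every z ∈ ℂ^k the limit α̃(z) := lim_n (1/n)·log^+ log^+ |f^n(z)| exists, with α̃(z) = log d_i if z ∈ U_i and α̃(z) = 0 if z ∈ K. In particular α̃ takes only the m+1 values 0, log d_1, …, log d_m and is lower semicontinuous on ℂ^k. -/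
open MvPolynomial Filter Topology Metric Set

noncomputable section

def logPlus (x : ℝ) : ℝ := max (Real.log x) 0

/-- The top-degree homogeneous part of the `j`-th coordinate polynomial of `P`. -/
def pPlus (k : ℕ) (P : Fin k → MvPolynomial (Fin k) ℂ) (j : Fin k) :
    MvPolynomial (Fin k) ℂ :=
  homogeneousComponent (P j).totalDegree (P j)

/-- `Σ_i`: unit-sphere slice of the affine cone over the attracting set `X_i` at
infinity: `‖w‖ = 1`, `P⁺_{(1)}(w) = ⋯ = P⁺_{(i−1)}(w) = 0` and `w_{(>i)} = 0`. -/
def sigmaSet (k : ℕ) (P : Fin k → MvPolynomial (Fin k) ℂ) (l : ℕ → ℕ) (i : ℕ) :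
    Set (EuclideanSpace ℂ (Fin k)) :=
  {w | ‖w‖ = 1 ∧ (∀ j : Fin k, (j : ℕ) < l (i - 1) → eval (fun t => w t) (pPlus k P j) = 0) ∧
    ∀ j : Fin k, l i ≤ (j : ℕ) → w j = 0}

/-- `U_i`: basin of the attracting set `X_i` at infinity. -/
def basin (k : ℕ) (f : EuclideanSpace ℂ (Fin k) → EuclideanSpace ℂ (Fin k))
    (P : Fin k → MvPolynomial (Fin k) ℂ) (l : ℕ → ℕ) (i : ℕ) :
    Set (EuclideanSpace ℂ (Fin k)) :=
  {z | Tendsto (fun n => ‖f^[n] z‖) atTop atTop ∧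
    Tendsto (fun n => infDist (‖f^[n] z‖⁻¹ • f^[n] z) (sigmaSet k P l i)) atTop (𝓝 0)}

/-- `K_i = K_{i−1} \ U_i` (with `K_0 = ℂ^k`), unfolded as the complement of
`U_1 ∪ ⋯ ∪ U_i`. -/
def kSet (k : ℕ) (f : EuclideanSpace ℂ (Fin k) → EuclideanSpace ℂ (Fin k))
    (P : Fin k → MvPolynomial (Fin k) ℂ) (l : ℕ → ℕ) (i : ℕ) :
    Set (EuclideanSpace ℂ (Fin k)) :=
  {z | ∀ j : ℕ, 1 ≤ j → j ≤ i → z ∉ basin k f P l j}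

/-- Euclidean norm of the sub-vector of the coordinates `a ≤ j < b`. -/
def blockNorm (k : ℕ) (z : EuclideanSpace ℂ (Fin k)) (a b : ℕ) : ℝ :=
  Real.sqrt (∑ j : Fin k, if a ≤ (j : ℕ) ∧ (j : ℕ) < b then ‖z j‖ ^ 2 else 0)

end

/-- The ideal of the linear subspace where the first `n` coordinates vanish has height at least
`n`. -/
lemma le_height_ker_aeval_X {k : ℕ} (n : ℕ) (hn : n ≤ k) :
    (n : ℕ∞) ≤ (RingHom.ker (aeval (R := ℂ) (fun i : Fin k =>
      if (i : ℕ) < n then (0 : MvPolynomial (Fin k) ℂ) else X i))).height := by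
  induction n with
  | zero => simp
  | succ n ih =>
    have hlt : RingHom.ker (aeval (R := ℂ) (fun i : Fin k =>
        if (i : ℕ) < n then (0 : MvPolynomial (Fin k) ℂ) else X i)) <
        RingHom.ker (aeval (R := ℂ) (fun i : Fin k =>
        if (i : ℕ) < n + 1 then (0 : MvPolynomial (Fin k) ℂ) else X i)) := by
      refine lt_of_le_of_ne (fun p hp => ?_) (fun h => ?_)
      · have hcomp : (aeval (R := ℂ) (fun i : Fin k =>
            if (i : ℕ) < n + 1 then (0 : MvPolynomial (Fin k) ℂ) else X i)).comp
            (aeval (R := ℂ) (fun i : Fin k =>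
              if (i : ℕ) < n then (0 : MvPolynomial (Fin k) ℂ) else X i)) =
            aeval (R := ℂ) (fun i : Fin k =>
              if (i : ℕ) < n + 1 then (0 : MvPolynomial (Fin k) ℂ) else X i) := by
          ext1 i
          by_cases hi : (i : ℕ) < n
          · simp [hi, hi.le]
          · simp [hi]
        rw [RingHom.mem_ker] at hp ⊢
        rw [← hcomp, AlgHom.comp_apply, hp, map_zero]
      · have hX : (X ⟨n, hn⟩ : MvPolynomial (Fin k) ℂ) ∈ RingHom.ker (aeval (R := ℂ)
            (fun i : Fin k => if (i : ℕ) < n then (0 : MvPolynomial (Fin k) ℂ) else X i)) := by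
          rw [h, RingHom.mem_ker]
          simp
        rw [RingHom.mem_ker] at hX
        simp [X_ne_zero] at hX
    have := RingHom.ker_isPrime (aeval (R := ℂ) (fun i : Fin k =>
        if (i : ℕ) < n then (0 : MvPolynomial (Fin k) ℂ) else X i))
    have := RingHom.ker_isPrime (aeval (R := ℂ) (fun i : Fin k =>
        if (i : ℕ) < n + 1 then (0 : MvPolynomial (Fin k) ℂ) else X i))
    push_cast
    exact (add_le_add_left (ih (by lia)) 1).trans
      (Ideal.height_add_one_le_of_lt_of_isPrime hlt)

/-- Fewer than `k` polynomials in `k` variables vanishing at the origin have a common zero away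
from the origin. -/
lemma exists_ne_zero_eval_eq_zero {k : ℕ} (Q : Fin k → MvPolynomial (Fin k) ℂ) (j₀ : Fin k)
    (hQ : ∀ j ≠ j₀, eval 0 (Q j) = 0) :
    ∃ w : Fin k → ℂ, w ≠ 0 ∧ ∀ j ≠ j₀, eval w (Q j) = 0 := by
  classical
  by_contra! hcon
  set s : Finset (MvPolynomial (Fin k) ℂ) := (Finset.univ.erase j₀).image Q with hs
  set M : Ideal (MvPolynomial (Fin k) ℂ) := vanishingIdeal ℂ {(0 : Fin k → ℂ)} with hM
  have hlocus : zeroLocus ℂ (Ideal.span (s : Set (MvPolynomial (Fin k) ℂ))) = {0} := by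
    rw [zeroLocus_span]
    ext w
    simp only [hs, Finset.coe_image, Set.mem_ofPred_eq, Set.mem_image, Set.mem_singleton_iff]
    constructor
    · intro h
      by_contra hw
      obtain ⟨j, hj, hne⟩ := hcon w hw
      exact hne (by simpa [aeval_eq_eval] using h (Q j) ⟨j, by simpa using hj, rfl⟩)
    · rintro rfl p ⟨j, hj, rfl⟩
      simpa [aeval_eq_eval] using hQ j (by simpa using hj)
  have hrad : (Ideal.span (s : Set (MvPolynomial (Fin k) ℂ))).radical = M := by
    rw [← vanishingIdeal_zeroLocus_eq_radical (K := ℂ), hlocus]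
  have hmin : M ∈ (Ideal.span (s : Set (MvPolynomial (Fin k) ℂ))).minimalPrimes := by
    rw [← Ideal.radical_minimalPrimes, hrad, Ideal.minimalPrimes_eq_subsingleton_self]
    rfl
  have hle : M.height ≤ s.card := Ideal.height_le_card_of_mem_minimalPrimes_span_finset hmin
  have hge : (k : ℕ∞) ≤ M.height := by
    refine (le_height_ker_aeval_X k le_rfl).trans (Ideal.height_mono fun p hp => ?_)
    rw [hM, mem_vanishingIdeal_singleton_iff]
    rw [RingHom.mem_ker] at hp
    have := congrArg (aeval (R := ℂ) (0 : Fin k → ℂ)) hp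
    rw [← AlgHom.comp_apply, map_zero] at this
    convert this using 2
    ext i
    simp
  have hcard : s.card ≤ k - 1 := by
    refine Finset.card_image_le.trans ?_
    simp [Finset.card_erase_of_mem]
  have hk : 0 < k := j₀.pos
  have := hge.trans hle
  have : k ≤ s.card := by exact_mod_cast this
  lia

lemma tendsto_zero_of_isCompact {X : Type*} [TopologicalSpace X] {S : Set X} (hS : IsCompact S)
    {u v : X → ℝ} (hu : Continuous u) (hv : Continuous v) (hu0 : ∀ x, 0 ≤ u x)
    (hv0 : ∀ x, 0 ≤ v x) (huv : ∀ x ∈ S, u x = 0 → v x = 0) {w : ℕ → X}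
    (hw : ∀ᶠ n in atTop, w n ∈ S) (h : Tendsto (fun n => u (w n)) atTop (𝓝 0)) :
    Tendsto (fun n => v (w n)) atTop (𝓝 0) := by
  rw [Metric.tendsto_atTop']
  intro δ hδ
  have hT : IsCompact (S ∩ {x | δ ≤ v x}) := hS.inter_right (isClosed_le continuous_const hv)
  have hc : ∃ c > 0, ∀ x ∈ S ∩ {x | δ ≤ v x}, c ≤ u x := by
    rcases (S ∩ {x | δ ≤ v x}).eq_empty_or_nonempty with he | hne
    · exact ⟨1, one_pos, by simp [he]⟩
    · obtain ⟨x, hx, hmin⟩ := hT.exists_isMinOn hne hu.continuousOn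
      refine ⟨u x, lt_of_le_of_ne (hu0 x) fun h0 => ?_, fun y hy => hmin hy⟩
      have h1 := huv x hx.1 h0.symm
      have h2 : δ ≤ v x := hx.2
      linarith
  obtain ⟨c, hc, hcu⟩ := hc
  obtain ⟨N, hN⟩ := eventually_atTop.1 ((h.eventually_lt_const hc).and hw)
  refine ⟨N, fun n hn => ?_⟩
  obtain ⟨h1, h2⟩ := hN n hn.le
  rw [Real.dist_0_eq_abs, abs_of_nonneg (hv0 _)]
  by_contra! hge
  exact absurd (hcu _ ⟨h2, hge⟩) (not_le.2 h1)

lemma logPlus_nonneg (x : ℝ) : 0 ≤ logPlus x := le_max_right _ _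

lemma logPlus_le {x : ℝ} (hx : 0 ≤ x) : logPlus x ≤ x :=
  max_le (Real.log_le_self hx) hx

lemma logPlus_eq_log {x : ℝ} (hx : 1 ≤ x) : logPlus x = Real.log x :=
  max_eq_left (Real.log_nonneg hx)

lemma tendsto_inv_mul_logPlus_of_bounded {N : ℕ → ℝ} (h0 : ∀ n, 0 ≤ N n) {C : ℝ}
    (hC : ∀ n, N n ≤ C) :
    Tendsto (fun n : ℕ => (n : ℝ)⁻¹ * logPlus (logPlus (N n))) atTop (𝓝 0) := by
  refine squeeze_zero (g := fun n : ℕ => (n : ℝ)⁻¹ * C)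
    (fun n => mul_nonneg (by positivity) (logPlus_nonneg _)) (fun n => ?_) ?_
  · gcongr
    exact (logPlus_le (logPlus_nonneg _)).trans ((logPlus_le (h0 n)).trans (hC n))
  · simpa using (tendsto_inv_atTop_nhds_zero_nat (𝕜 := ℝ)).mul_const C

/-- If `N (n + 1)` is comparable to `N n ^ d`, then `N` has double exponential growth rate
`log d`. -/
lemma tendsto_inv_mul_logPlus_of_comparable {N : ℕ → ℝ} (hN : Tendsto N atTop atTop) {c M : ℝ}
    (hc : 0 < c) {d : ℕ} (hd : 1 ≤ d)
    (hlow : ∀ᶠ n in atTop, c * N n ^ d ≤ N (n + 1))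
    (hup : ∀ᶠ n in atTop, N (n + 1) ≤ M * N n ^ d) :
    Tendsto (fun n : ℕ => (n : ℝ)⁻¹ * logPlus (logPlus (N n))) atTop (𝓝 (Real.log d)) := by
  set a : ℕ → ℝ := fun n => Real.log (N n) with ha
  have hainf : Tendsto a atTop atTop := Real.tendsto_log_atTop.comp hN
  have hratio : Tendsto (fun n => a (n + 1) / a n) atTop (𝓝 d) := by
    have hconst : ∀ b : ℝ, Tendsto (fun n => b / a n + d) atTop (𝓝 d) := fun b => by
      simpa using (tendsto_const_nhds.div_atTop hainf).add_const (d : ℝ)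
    refine tendsto_of_tendsto_of_tendsto_of_le_of_le' (hconst (Real.log c))
      (hconst (Real.log M)) ?_ ?_
    · filter_upwards [hlow, hainf.eventually_gt_atTop 0, hN.eventually_gt_atTop 0]
        with n h1 h2 h3
      have := Real.log_le_log (by positivity) h1
      rw [Real.log_mul hc.ne' (by positivity), Real.log_pow] at this
      rw [← sub_nonneg]
      have e : a (n + 1) / a n - (Real.log c / a n + d) =
        (a (n + 1) - (Real.log c + d * a n)) / a n := by field_simp
      rw [e]
      exact div_nonneg (by simp only [ha]; linarith) h2.le
    · filter_upwards [hup, hainf.eventually_gt_atTop 0, hN.eventually_gt_atTop 0,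
        (tendsto_add_atTop_iff_nat 1).2 hN |>.eventually_gt_atTop 0] with n h1 h2 h3 h4
      have hM : 0 < M := by
        by_contra! hM
        have : M * N n ^ d ≤ 0 := mul_nonpos_of_nonpos_of_nonneg hM (by positivity)
        linarith
      have := Real.log_le_log h4 h1
      rw [Real.log_mul hM.ne' (by positivity), Real.log_pow] at this
      rw [← sub_nonneg]
      have e : (Real.log M / a n + d) - a (n + 1) / a n =
        ((Real.log M + d * a n) - a (n + 1)) / a n := by field_simp
      rw [e]
      exact div_nonneg (by simp only [ha]; linarith) h2.le
  have hd0 : (d : ℝ) ≠ 0 := by positivity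
  have hdiff : Tendsto (fun n => Real.log (a (n + 1)) - Real.log (a n)) atTop
      (𝓝 (Real.log d)) := by
    refine ((Real.continuousAt_log hd0).tendsto.comp hratio).congr' ?_
    filter_upwards [hainf.eventually_gt_atTop 0,
      (tendsto_add_atTop_iff_nat 1).2 hainf |>.eventually_gt_atTop 0] with n h1 h2
    exact Real.log_div h2.ne' h1.ne'
  have hces := hdiff.cesaro
  have hzero : Tendsto (fun n : ℕ => (n : ℝ)⁻¹ * Real.log (a 0)) atTop (𝓝 0) := by
    simpa using (tendsto_inv_atTop_nhds_zero_nat (𝕜 := ℝ)).mul_const (Real.log (a 0))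
  have hsum := hces.add hzero
  rw [add_zero] at hsum
  refine hsum.congr' ?_
  filter_upwards [hainf.eventually_ge_atTop 1, hN.eventually_ge_atTop 1] with n h1 h2
  rw [Finset.sum_range_sub (fun n => Real.log (a n)), ← mul_add, sub_add_cancel,
    logPlus_eq_log h2, logPlus_eq_log h1]

lemma MvPolynomial.IsHomogeneous.sum_eq {k n : ℕ} {p : MvPolynomial (Fin k) ℂ}
    (hp : p.IsHomogeneous n) {e : Fin k →₀ ℕ} (he : e ∈ p.support) : ∑ i, e i = n := by
  have := hp (mem_support_iff.1 he)
  simpa [Finsupp.weight_apply, Finsupp.sum_fintype] using this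

lemma norm_eval_smul {k n : ℕ} {p : MvPolynomial (Fin k) ℂ} (hp : p.IsHomogeneous n) {r : ℝ}
    (hr : 0 ≤ r) (z : EuclideanSpace ℂ (Fin k)) :
    ‖eval (fun t => (r • z) t) p‖ = r ^ n * ‖eval (fun t => z t) p‖ := by
  have : eval (fun t => (r • z) t) p = (r : ℂ) ^ n * eval (fun t => z t) p := by
    rw [eval_eq', eval_eq', Finset.mul_sum]
    refine Finset.sum_congr rfl fun e he => ?_
    rw [← hp.sum_eq he, ← Finset.prod_pow_eq_pow_sum]
    simp only [PiLp.smul_apply, Complex.real_smul, mul_pow, Finset.prod_mul_distrib]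
    ring
  rw [this, norm_mul, norm_pow, Complex.norm_of_nonneg hr]

lemma continuous_eval_coord {k : ℕ} (p : MvPolynomial (Fin k) ℂ) :
    Continuous fun z : EuclideanSpace ℂ (Fin k) => eval (fun t => z t) p :=
  (MvPolynomial.continuous_eval p).comp (by fun_prop)

lemma exists_norm_eval_le_of_isHomogeneous {k n : ℕ} {p : MvPolynomial (Fin k) ℂ}
    (hp : p.IsHomogeneous n) :
    ∃ C, 0 ≤ C ∧ ∀ z : EuclideanSpace ℂ (Fin k),
      ‖eval (fun t => z t) p‖ ≤ C * ‖z‖ ^ n := by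
  refine ⟨∑ e ∈ p.support, ‖coeff e p‖, Finset.sum_nonneg fun _ _ => norm_nonneg _, fun z => ?_⟩
  rw [eval_eq', Finset.sum_mul]
  refine (norm_sum_le _ _).trans (Finset.sum_le_sum fun e he => ?_)
  rw [norm_mul, norm_prod, ← hp.sum_eq he, ← Finset.prod_pow_eq_pow_sum]
  gcongr with i
  rw [norm_pow]
  gcongr
  exact PiLp.norm_apply_le z i

lemma exists_norm_eval_sub_top_le {k : ℕ} (p : MvPolynomial (Fin k) ℂ) :
    ∃ C, 0 ≤ C ∧ ∀ z : EuclideanSpace ℂ (Fin k), 1 ≤ ‖z‖ →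
      ‖eval (fun t => z t) p -
        eval (fun t => z t) (homogeneousComponent p.totalDegree p)‖ * ‖z‖ ≤
        C * ‖z‖ ^ p.totalDegree := by
  choose C hC0 hC using fun n =>
    exists_norm_eval_le_of_isHomogeneous (homogeneousComponent_isHomogeneous n p)
  refine ⟨∑ n ∈ Finset.range p.totalDegree, C n, Finset.sum_nonneg fun n _ => hC0 n,
    fun z hz => ?_⟩
  have hsub : eval (fun t => z t) p -
      eval (fun t => z t) (homogeneousComponent p.totalDegree p) =
      ∑ n ∈ Finset.range p.totalDegree, eval (fun t => z t) (homogeneousComponent n p) := by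
    conv_lhs => rw [← congrArg (eval fun t => z t) (sum_homogeneousComponent p)]
    rw [Finset.sum_range_succ, map_add, map_sum, add_sub_cancel_right]
  rw [hsub, Finset.sum_mul]
  calc _ ≤ (∑ n ∈ Finset.range p.totalDegree,
        ‖eval (fun t => z t) (homogeneousComponent n p)‖) * ‖z‖ := by
        gcongr
        exact norm_sum_le _ _
    _ ≤ _ := by
        rw [Finset.sum_mul]
        refine Finset.sum_le_sum fun n hn => ?_
        calc _ ≤ C n * ‖z‖ ^ n * ‖z‖ := by gcongr; exact hC n z
          _ = C n * ‖z‖ ^ (n + 1) := by ring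
          _ ≤ _ := by
            have := Finset.mem_range.1 hn
            gcongr
            · exact hC0 n
            · lia

lemma pPlus_isHomogeneous {k : ℕ} (P : Fin k → MvPolynomial (Fin k) ℂ) (j : Fin k) :
    (pPlus k P j).IsHomogeneous (P j).totalDegree :=
  homogeneousComponent_isHomogeneous _ _

lemma exists_uniform_bound {k : ℕ} (P : Fin k → MvPolynomial (Fin k) ℂ) :
    ∃ C, 0 ≤ C ∧ ∀ (j : Fin k) (z : EuclideanSpace ℂ (Fin k)), 1 ≤ ‖z‖ →
      ‖eval (fun t => z t) (P j)‖ ≤ C * ‖z‖ ^ (P j).totalDegree ∧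
      ‖eval (fun t => z t) (P j) - eval (fun t => z t) (pPlus k P j)‖ * ‖z‖ ≤
        C * ‖z‖ ^ (P j).totalDegree := by
  choose A hA0 hA using fun j => exists_norm_eval_le_of_isHomogeneous (pPlus_isHomogeneous P j)
  choose B hB0 hB using fun j => exists_norm_eval_sub_top_le (P j)
  refine ⟨∑ j, (A j + B j), Finset.sum_nonneg fun j _ => add_nonneg (hA0 j) (hB0 j),
    fun j z hz => ?_⟩
  have hle : A j + B j ≤ ∑ j, (A j + B j) :=
    Finset.single_le_sum (f := fun j => A j + B j)
      (fun j _ => add_nonneg (hA0 j) (hB0 j)) (Finset.mem_univ j)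
  have hpow : 0 ≤ ‖z‖ ^ (P j).totalDegree := by positivity
  have h1 := hA j z
  have h2 := hB j z hz
  have h3 := mul_le_mul_of_nonneg_right hle hpow
  have h4 := mul_nonneg (hA0 j) hpow
  have h5 := mul_le_mul_of_nonneg_left hz (norm_nonneg
    (eval (fun t => z t) (P j) - eval (fun t => z t) (pPlus k P j)))
  have h6 := norm_le_norm_sub_add (eval (fun t => z t) (P j)) (eval (fun t => z t) (pPlus k P j))
  rw [add_mul] at h3
  unfold pPlus at *
  constructor <;> linarith

/-- The cone neighbourhood at infinity of the subspace where the coordinates of index at least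
`a` vanish. -/
def infinityCone (k : ℕ) (ε R : ℝ) (a : ℕ) : Set (EuclideanSpace ℂ (Fin k)) :=
  {z | R < ‖z‖ ∧ ∀ j : Fin k, a ≤ (j : ℕ) → ‖z j‖ < ε * ‖z‖}

lemma isOpen_infinityCone (k : ℕ) (ε R : ℝ) (a : ℕ) : IsOpen (infinityCone k ε R a) := by
  have : infinityCone k ε R a = {z | R < ‖z‖} ∩
      ⋂ j : Fin k, ⋂ _ : a ≤ (j : ℕ), {z | ‖z j‖ < ε * ‖z‖} := by
    ext z
    simp [infinityCone]
  rw [this]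
  refine (isOpen_lt continuous_const continuous_norm).inter
    (isOpen_iInter_of_finite fun j => isOpen_iInter_of_finite fun _ => ?_)
  exact isOpen_lt (by fun_prop) (by fun_prop)

/-- On a thin cone around `{z | ∀ j ≥ a, z j = 0}`, homogeneous polynomials without common zero
on this subspace are bounded below. -/
lemma exists_le_norm_eval_of_regular {k : ℕ} (hk : 0 < k) (Q : Fin k → MvPolynomial (Fin k) ℂ)
    (D : Fin k → ℕ) (hQ : ∀ j, (Q j).IsHomogeneous (D j)) (a : ℕ)
    (h : ∀ z : Fin k → ℂ, (∀ j : Fin k, (j : ℕ) < a → eval z (Q j) = 0) →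
      (∀ j : Fin k, a ≤ (j : ℕ) → z j = 0) → z = 0) :
    ∃ δ > 0, ∀ z : EuclideanSpace ℂ (Fin k), 0 < ‖z‖ →
      (∀ j : Fin k, a ≤ (j : ℕ) → ‖z j‖ < δ * ‖z‖) →
      ∃ j : Fin k, (j : ℕ) < a ∧ δ * ‖z‖ ^ D j ≤ ‖eval (fun t => z t) (Q j)‖ := by
  have : Nonempty (Fin k) := ⟨⟨0, hk⟩⟩
  set g : Fin k → EuclideanSpace ℂ (Fin k) → ℝ := fun j w =>
    if (j : ℕ) < a then ‖eval (fun t => w t) (Q j)‖ else ‖w j‖ with hg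
  have hg0 : ∀ j w, 0 ≤ g j w := fun j w => by
    simp only [hg]
    split_ifs <;> exact norm_nonneg _
  have hgc : Continuous fun w => ∑ j, g j w := by
    refine continuous_finsetSum _ fun j _ => ?_
    simp only [hg]
    split_ifs
    · exact (continuous_eval_coord _).norm
    · fun_prop
  have hsphere : (sphere (0 : EuclideanSpace ℂ (Fin k)) 1).Nonempty :=
    NormedSpace.sphere_nonempty.2 zero_le_one
  obtain ⟨w₀, hw₀, hmin⟩ := (isCompact_sphere (0 : EuclideanSpace ℂ (Fin k)) 1).exists_isMinOn
    hsphere hgc.continuousOn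
  set s := ∑ j, g j w₀ with hs
  have hspos : 0 < s := by
    refine lt_of_le_of_ne (Finset.sum_nonneg fun j _ => hg0 j w₀) fun h0 => ?_
    have hall := (Finset.sum_eq_zero_iff_of_nonneg fun j _ => hg0 j w₀).1 h0.symm
    have hz := h (fun t => w₀ t) (fun j hj => by simpa [hg, hj] using hall j (Finset.mem_univ j))
      (fun j hj => by simpa [hg, not_lt.2 hj] using hall j (Finset.mem_univ j))
    have : w₀ = 0 := by
      ext t
      exact congrFun hz t
    simp [this] at hw₀
  refine ⟨s / k, by positivity, fun z hz hzj => ?_⟩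
  have hw : ‖z‖⁻¹ • z ∈ sphere (0 : EuclideanSpace ℂ (Fin k)) 1 := by
    simp [norm_smul, hz.ne']
  have hsum : s ≤ ∑ j, g j (‖z‖⁻¹ • z) := hmin hw
  obtain ⟨j, -, hj⟩ : ∃ j ∈ Finset.univ, s / k ≤ g j (‖z‖⁻¹ • z) := by
    refine Finset.exists_le_of_sum_le Finset.univ_nonempty ?_
    have : (k : ℝ) ≠ 0 := by positivity
    simpa [mul_div_cancel₀ _ this] using hsum
  by_cases hja : (j : ℕ) < a
  · refine ⟨j, hja, ?_⟩
    simp only [hg, hja, if_true, norm_eval_smul (hQ j) (inv_nonneg.2 hz.le)] at hj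
    rwa [inv_pow, inv_mul_eq_div, le_div_iff₀ (by positivity)] at hj
  · exfalso
    have h1 := hzj j (not_lt.1 hja)
    simp only [hg, hja, if_false, PiLp.smul_apply, norm_smul, norm_inv, norm_norm] at hj
    rw [inv_mul_eq_div, le_div_iff₀ hz] at hj
    linarith

/-- A constant that works for all indices up to `m` at once, for a family of properties of small
positive reals. -/
lemma exists_pos_forall_le {p : ℕ → ℝ → Prop} (hp : ∀ i δ ε, 0 < δ → δ ≤ ε → p i ε → p i δ) (m : ℕ)
    (h : ∀ i ≤ m, ∃ δ > 0, p i δ) : ∃ δ > 0, ∀ i ≤ m, p i δ := by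
  induction m with
  | zero =>
    obtain ⟨δ, hδ, hpδ⟩ := h 0 le_rfl
    exact ⟨δ, hδ, fun i hi => by rwa [Nat.le_zero.1 hi]⟩
  | succ m ih =>
    obtain ⟨δ, hδ, hpδ⟩ := ih fun i hi => h i (hi.trans m.le_succ)
    obtain ⟨η, hη, hpη⟩ := h (m + 1) le_rfl
    refine ⟨min δ η, lt_min hδ hη, fun i hi => ?_⟩
    rcases Nat.le_succ_iff.1 hi with hi | rfl
    · exact hp i _ _ (lt_min hδ hη) (min_le_left _ _) (hpδ i hi)
    · exact hp _ _ _ (lt_min hδ hη) (min_le_right _ _) hpη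

/-- The estimates near infinity satisfied by a regular map, with respect to the cones
`infinityCone k ε R (l i)`. -/
structure IsFilteredAtInfinity (k m : ℕ) (l d : ℕ → ℕ) (P : Fin k → MvPolynomial (Fin k) ℂ)
    (f : EuclideanSpace ℂ (Fin k) → EuclideanSpace ℂ (Fin k)) (ε c C R : ℝ) : Prop where
  eps_pos : 0 < ε
  const_pos : 0 < c
  bound_nonneg : 0 ≤ C
  one_le_radius : 1 ≤ R
  eval_eq : ∀ z j, f z j = eval (fun t => z t) (P j)
  cont : Continuous f
  zero_index : l 0 = 0
  last_index : l m = k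
  index_lt : ∀ i < m, l i < l (i + 1)
  le_degree : ∀ i, 1 ≤ i → i ≤ m → ∀ j : Fin k, (j : ℕ) < l i → d i ≤ (P j).totalDegree
  degree_le : ∀ i, 1 ≤ i → i ≤ m → ∀ j : Fin k, l (i - 1) ≤ (j : ℕ) → (P j).totalDegree ≤ d i
  degree_lt : ∀ i, 1 ≤ i → i < m → d (i + 1) < d i
  two_le_degree : ∀ i, 1 ≤ i → i ≤ m → 2 ≤ d i
  coercive : ∀ i ≤ m, ∀ z ∈ infinityCone k ε R (l i), ∃ j : Fin k, (j : ℕ) < l i ∧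
    ε * ‖z‖ ^ (P j).totalDegree ≤ ‖eval (fun t => z t) (pPlus k P j)‖
  growth : ∀ i, 1 ≤ i → i ≤ m → ∀ z ∈ infinityCone k ε R (l i), c * ‖z‖ ^ d i ≤ ‖f z‖
  double : ∀ i, 1 ≤ i → i ≤ m → ∀ z ∈ infinityCone k ε R (l i), 2 * ‖z‖ ≤ ‖f z‖
  mapsTo : ∀ i, 1 ≤ i → i ≤ m →
    MapsTo f (infinityCone k ε R (l i)) (infinityCone k ε R (l i))
  norm_apply_le : ∀ z, 1 ≤ ‖z‖ → ∀ j, ‖f z j‖ ≤ C * ‖z‖ ^ (P j).totalDegree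
  norm_sub_le : ∀ z, 1 ≤ ‖z‖ → ∀ j, ‖f z j - eval (fun t => z t) (pPlus k P j)‖ * ‖z‖ ≤
    C * ‖z‖ ^ (P j).totalDegree

lemma exists_isFilteredAtInfinity {k m : ℕ} (hk : 0 < k) {l : ℕ → ℕ} (hl0 : l 0 = 0)
    (hlm : l m = k) (hlmono : ∀ i < m, l i < l (i + 1)) {P : Fin k → MvPolynomial (Fin k) ℂ}
    {d : ℕ → ℕ}
    (hdeg : ∀ i, 1 ≤ i → i ≤ m → ∀ j : Fin k,
      l (i - 1) ≤ (j : ℕ) → (j : ℕ) < l i → (P j).totalDegree = d i)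
    (hdmono : ∀ i, 1 ≤ i → i < m → d (i + 1) < d i)
    {f : EuclideanSpace ℂ (Fin k) → EuclideanSpace ℂ (Fin k)}
    (hf : ∀ (z : EuclideanSpace ℂ (Fin k)) (j : Fin k), f z j = eval (fun t => z t) (P j))
    (hcont : Continuous f)
    (hreg : ∀ r, 1 ≤ r → r ≤ m → ∀ z : Fin k → ℂ,
      (∀ j : Fin k, (j : ℕ) < l r → eval z (pPlus k P j) = 0) →
      (∀ j : Fin k, l r ≤ (j : ℕ) → z j = 0) → z = 0)
    (hdm2 : 2 ≤ d m) :
    ∃ ε c C R, IsFilteredAtInfinity k m l d P f ε c C R := by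
  have hdanti : ∀ a b, 1 ≤ a → a ≤ b → b ≤ m → d b ≤ d a := fun a b ha hab => by
    induction b, hab using Nat.le_induction with
    | base => exact fun _ => le_rfl
    | succ n hn ih => exact fun hm => (hdmono n (ha.trans hn) hm).le.trans (ih (by lia))
  have hlow : ∀ i, 1 ≤ i → i ≤ m → ∀ j : Fin k, (j : ℕ) < l i → d i ≤ (P j).totalDegree := by
    intro i hi
    induction i, hi using Nat.le_induction with
    | base =>
      intro hm j hj
      exact (hdeg 1 le_rfl hm j (by simp [hl0]) hj).ge
    | succ n hn ih =>
      intro hm j hj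
      rcases lt_or_ge (j : ℕ) (l n) with h | h
      · exact (hdmono n hn hm).le.trans (ih (by lia) j h)
      · exact (hdeg (n + 1) (by lia) hm j h hj).ge
  have hhigh : ∀ i, 1 ≤ i → i ≤ m → ∀ j : Fin k, l (i - 1) ≤ (j : ℕ) →
      (P j).totalDegree ≤ d i := by
    intro i hi hm j hj
    have hex : ∃ n, (j : ℕ) < l n ∧ n ≤ m := ⟨m, by rw [hlm]; exact j.2, le_rfl⟩
    classical
    obtain ⟨hn1, hn2⟩ := Nat.find_spec hex
    set n := Nat.find hex with hn
    have hn0 : n ≠ 0 := fun h0 => by simp [h0, hl0] at hn1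
    have hle : l (n - 1) ≤ (j : ℕ) := by
      have := Nat.find_min hex (m := n - 1) (by lia)
      by_contra! hlt
      exact this ⟨hlt, by lia⟩
    have hlanti : ∀ b, n ≤ b → b ≤ m → l n ≤ l b := fun b hab => by
      induction b, hab using Nat.le_induction with
      | base => exact fun _ => le_rfl
      | succ q hq ih => exact fun hqm => (ih (by lia)).trans (hlmono q hqm).le
    have hin : i ≤ n := by
      by_contra! hlt
      have := hlanti (i - 1) (by lia) (by lia)
      lia
    rw [hdeg n (by lia) hn2 j hle hn1]
    exact hdanti i n hi hin hn2
  have h2 : ∀ i, 1 ≤ i → i ≤ m → 2 ≤ d i := fun i hi hm =>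
    hdm2.trans (hdanti i m hi hm le_rfl)
  have hreg0 : ∀ r ≤ m, ∀ z : Fin k → ℂ,
      (∀ j : Fin k, (j : ℕ) < l r → eval z (pPlus k P j) = 0) →
      (∀ j : Fin k, l r ≤ (j : ℕ) → z j = 0) → z = 0 := by
    intro r hr z h1 hz
    rcases Nat.eq_zero_or_pos r with rfl | hr0
    · funext j
      exact hz j (by simp [hl0])
    · exact hreg r hr0 hr z h1 hz
  obtain ⟨ε, hε, hcoer⟩ := exists_pos_forall_le (m := m)
    (p := fun i δ => ∀ z : EuclideanSpace ℂ (Fin k), 0 < ‖z‖ →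
      (∀ j : Fin k, l i ≤ (j : ℕ) → ‖z j‖ < δ * ‖z‖) →
      ∃ j : Fin k, (j : ℕ) < l i ∧
        δ * ‖z‖ ^ (P j).totalDegree ≤ ‖eval (fun t => z t) (pPlus k P j)‖)
    (fun i δ η _ hδη h z hz hzj => by
      obtain ⟨j, hj, hle⟩ := h z hz fun j hj => (hzj j hj).trans_le (by gcongr)
      exact ⟨j, hj, le_trans (by gcongr) hle⟩)
    (fun i hi => exists_le_norm_eval_of_regular hk _ _ (pPlus_isHomogeneous P) _ (hreg0 i hi))
  obtain ⟨C, hC0, hC⟩ := exists_uniform_bound P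
  have hfC : ∀ z : EuclideanSpace ℂ (Fin k), 1 ≤ ‖z‖ → ∀ j,
      ‖f z j‖ ≤ C * ‖z‖ ^ (P j).totalDegree := fun z hz j => by
    rw [hf]
    exact (hC j z hz).1
  set c := ε / 2 with hc
  have hcpos : 0 < c := by positivity
  set R := max 1 (max (2 / c) (max (C / c) (C / (c * ε) + 1))) with hR
  have hR1 : 1 ≤ R := le_max_left _ _
  have hRc : 2 / c ≤ R := (le_max_left _ _).trans (le_max_right _ _)
  have hRC : C / c ≤ R := (le_max_left _ _).trans ((le_max_right _ _).trans (le_max_right _ _))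
  have hRe : C / (c * ε) < R := (lt_add_one _).trans_le
    ((le_max_right _ _).trans ((le_max_right _ _).trans (le_max_right _ _)))
  rw [div_le_iff₀ hcpos] at hRc hRC
  rw [div_lt_iff₀ (by positivity)] at hRe
  have hcoer' : ∀ i ≤ m, ∀ z ∈ infinityCone k ε R (l i), ∃ j : Fin k, (j : ℕ) < l i ∧
      ε * ‖z‖ ^ (P j).totalDegree ≤ ‖eval (fun t => z t) (pPlus k P j)‖ := fun i hi z hz =>
    hcoer i hi z (by linarith [hz.1]) hz.2
  have hgrowth : ∀ i, 1 ≤ i → i ≤ m → ∀ z ∈ infinityCone k ε R (l i),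
      c * ‖z‖ ^ d i ≤ ‖f z‖ := by
    intro i hi hm z hz
    obtain ⟨j, hj, hle⟩ := hcoer' i hm z hz
    have hz1 : 1 ≤ ‖z‖ := by linarith [hz.1]
    have hz0 : 0 < ‖z‖ := by linarith
    have h1 := (hC j z hz1).2
    rw [← hf] at h1
    set D := (P j).totalDegree
    have h3 : ‖f z j - eval (fun t => z t) (pPlus k P j)‖ ≤ c * ‖z‖ ^ D := by
      refine le_of_mul_le_mul_right (h1.trans ?_) hz0
      have : C ≤ c * ‖z‖ := by nlinarith [hz.1]
      calc C * ‖z‖ ^ D ≤ (c * ‖z‖) * ‖z‖ ^ D := by gcongr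
        _ = c * ‖z‖ ^ D * ‖z‖ := by ring
    have h4 := norm_le_norm_sub_add (eval (fun t => z t) (pPlus k P j)) (f z j)
    rw [norm_sub_rev] at h4
    have h5 : c * ‖z‖ ^ d i ≤ c * ‖z‖ ^ D := by
      gcongr
      exact hlow i hi hm j hj
    have h6 : ε * ‖z‖ ^ D = c * ‖z‖ ^ D + c * ‖z‖ ^ D := by rw [hc]; ring
    linarith [PiLp.norm_apply_le (f z) j]
  have hdouble : ∀ i, 1 ≤ i → i ≤ m → ∀ z ∈ infinityCone k ε R (l i), 2 * ‖z‖ ≤ ‖f z‖ := by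
    intro i hi hm z hz
    have hz1 : 1 ≤ ‖z‖ := by linarith [hz.1]
    have h1 : 2 ≤ c * ‖z‖ := by nlinarith [hz.1]
    calc 2 * ‖z‖ ≤ (c * ‖z‖) * ‖z‖ := by gcongr
      _ = c * ‖z‖ ^ 2 := by ring
      _ ≤ c * ‖z‖ ^ d i := by
        gcongr
        exact h2 i hi hm
      _ ≤ _ := hgrowth i hi hm z hz
  refine ⟨ε, c, C, R, hε, hcpos, hC0, hR1, hf, hcont, hl0, hlm, hlmono, hlow, hhigh, hdmono, h2,
    hcoer', hgrowth, hdouble, fun i hi hm z hz => ⟨?_, fun j hj => ?_⟩, hfC, fun z hz j => ?_⟩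
  · linarith [hdouble i hi hm z hz, hz.1]
  · have hz1 : 1 ≤ ‖z‖ := by linarith [hz.1]
    have hz0 : 0 < ‖z‖ := by linarith
    have him : i < m := by
      refine lt_of_le_of_ne hm ?_
      rintro rfl
      have := j.2
      lia
    have hDj : (P j).totalDegree + 1 ≤ d i :=
      (Nat.succ_le_succ (hhigh (i + 1) (by lia) him j hj)).trans (hdmono i hi him)
    refine lt_of_mul_lt_mul_right ?_ hz0.le
    calc ‖f z j‖ * ‖z‖ ≤ C * ‖z‖ ^ (P j).totalDegree * ‖z‖ := by gcongr; exact hfC z hz1 j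
      _ = C * ‖z‖ ^ ((P j).totalDegree + 1) := by ring
      _ ≤ C * ‖z‖ ^ d i := by gcongr
      _ < (‖z‖ * (c * ε)) * ‖z‖ ^ d i := by
        gcongr
        nlinarith [hz.1, mul_pos hcpos hε]
      _ = ε * (c * ‖z‖ ^ d i) * ‖z‖ := by ring
      _ ≤ ε * ‖f z‖ * ‖z‖ := by gcongr; exact hgrowth i hi hm z hz
  · rw [hf]
    exact (hC j z hz).2

/-- A continuous function cutting out `sigmaSet k P l i` on the unit sphere. -/
noncomputable def sigmaDefect (k : ℕ) (P : Fin k → MvPolynomial (Fin k) ℂ) (l : ℕ → ℕ) (i : ℕ)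
    (w : EuclideanSpace ℂ (Fin k)) : ℝ :=
  ∑ j : Fin k, if (j : ℕ) < l (i - 1) then ‖eval (fun t => w t) (pPlus k P j)‖
    else if l i ≤ (j : ℕ) then ‖w j‖ else 0

lemma sigmaDefect_term_nonneg {k : ℕ} (P : Fin k → MvPolynomial (Fin k) ℂ) (l : ℕ → ℕ) (i : ℕ)
    (w : EuclideanSpace ℂ (Fin k)) (j : Fin k) :
    0 ≤ if (j : ℕ) < l (i - 1) then ‖eval (fun t => w t) (pPlus k P j)‖
      else if l i ≤ (j : ℕ) then ‖w j‖ else 0 := by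
  split_ifs <;> positivity

lemma sigmaDefect_nonneg {k : ℕ} (P : Fin k → MvPolynomial (Fin k) ℂ) (l : ℕ → ℕ) (i : ℕ)
    (w : EuclideanSpace ℂ (Fin k)) : 0 ≤ sigmaDefect k P l i w :=
  Finset.sum_nonneg fun j _ => sigmaDefect_term_nonneg P l i w j

lemma continuous_sigmaDefect {k : ℕ} (P : Fin k → MvPolynomial (Fin k) ℂ) (l : ℕ → ℕ) (i : ℕ) :
    Continuous (sigmaDefect k P l i) := by
  refine continuous_finsetSum _ fun j _ => ?_
  split_ifs
  · exact (continuous_eval_coord _).norm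
  · fun_prop
  · fun_prop

lemma norm_eval_le_sigmaDefect {k : ℕ} {P : Fin k → MvPolynomial (Fin k) ℂ} {l : ℕ → ℕ} {i : ℕ}
    {j : Fin k} (hj : (j : ℕ) < l (i - 1)) (w : EuclideanSpace ℂ (Fin k)) :
    ‖eval (fun t => w t) (pPlus k P j)‖ ≤ sigmaDefect k P l i w := by
  have := Finset.single_le_sum (fun j _ => sigmaDefect_term_nonneg P l i w j) (Finset.mem_univ j)
  simpa [sigmaDefect, hj] using this

lemma norm_apply_le_sigmaDefect {k : ℕ} {P : Fin k → MvPolynomial (Fin k) ℂ} {l : ℕ → ℕ} {i : ℕ}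
    (hl : l (i - 1) ≤ l i) {j : Fin k} (hj : l i ≤ (j : ℕ)) (w : EuclideanSpace ℂ (Fin k)) :
    ‖w j‖ ≤ sigmaDefect k P l i w := by
  have := Finset.single_le_sum (fun j _ => sigmaDefect_term_nonneg P l i w j) (Finset.mem_univ j)
  simpa [sigmaDefect, hj, not_lt.2 (hl.trans hj)] using this

lemma mem_sigmaSet_iff {k : ℕ} {P : Fin k → MvPolynomial (Fin k) ℂ} {l : ℕ → ℕ} {i : ℕ}
    (hl : l (i - 1) ≤ l i) {w : EuclideanSpace ℂ (Fin k)} :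
    w ∈ sigmaSet k P l i ↔ ‖w‖ = 1 ∧ sigmaDefect k P l i w = 0 := by
  constructor
  · rintro ⟨h1, h2, h3⟩
    refine ⟨h1, Finset.sum_eq_zero fun j _ => ?_⟩
    split_ifs with ha hb
    · rw [h2 j ha, norm_zero]
    · rw [h3 j hb, norm_zero]
    · rfl
  · rintro ⟨h1, h2⟩
    refine ⟨h1, fun j hj => ?_, fun j hj => ?_⟩
    · exact norm_le_zero_iff.1 (h2 ▸ norm_eval_le_sigmaDefect hj w)
    · exact norm_le_zero_iff.1 (h2 ▸ norm_apply_le_sigmaDefect hl hj w)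

/-- The orbit of `z` converges to `sigmaSet k P l i` in direction iff the defining functions of
this set tend to zero along the directions of the orbit. -/
lemma tendsto_infDist_sigmaSet_iff {k : ℕ} {P : Fin k → MvPolynomial (Fin k) ℂ} {l : ℕ → ℕ}
    {i : ℕ} (hl : l (i - 1) ≤ l i) (hne : (sigmaSet k P l i).Nonempty)
    {w : ℕ → EuclideanSpace ℂ (Fin k)} (hw : ∀ᶠ n in atTop, w n ∈ sphere 0 1) :
    Tendsto (fun n => infDist (w n) (sigmaSet k P l i)) atTop (𝓝 0) ↔
      Tendsto (fun n => sigmaDefect k P l i (w n)) atTop (𝓝 0) := by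
  have hclosed : IsClosed (sigmaSet k P l i) := by
    have : sigmaSet k P l i = {w | ‖w‖ = 1} ∩ {w | sigmaDefect k P l i w = 0} := by
      ext w
      exact mem_sigmaSet_iff hl
    rw [this]
    exact (isClosed_eq continuous_norm continuous_const).inter
      (isClosed_eq (continuous_sigmaDefect P l i) continuous_const)
  have hS := isCompact_sphere (0 : EuclideanSpace ℂ (Fin k)) 1
  constructor
  · refine tendsto_zero_of_isCompact hS (continuous_infDist_pt _) (continuous_sigmaDefect P l i)
      (fun _ => infDist_nonneg) (sigmaDefect_nonneg P l i) (fun x _ hx => ?_) hw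
    exact ((mem_sigmaSet_iff hl).1 ((hclosed.mem_iff_infDist_zero hne).2 hx)).2
  · refine tendsto_zero_of_isCompact hS (continuous_sigmaDefect P l i) (continuous_infDist_pt _)
      (sigmaDefect_nonneg P l i) (fun _ => infDist_nonneg) (fun x hxS hx => ?_) hw
    exact infDist_zero_of_mem ((mem_sigmaSet_iff hl).2 ⟨by simpa using hxS, hx⟩)

namespace IsFilteredAtInfinity

variable {k m : ℕ} {l d : ℕ → ℕ} {P : Fin k → MvPolynomial (Fin k) ℂ}
  {f : EuclideanSpace ℂ (Fin k) → EuclideanSpace ℂ (Fin k)} {ε c C R : ℝ}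

lemma index_pred_lt (H : IsFilteredAtInfinity k m l d P f ε c C R) {i : ℕ} (hi : 1 ≤ i)
    (him : i ≤ m) : l (i - 1) < l i := by
  have := H.index_lt (i - 1) (by lia)
  rwa [Nat.sub_add_cancel hi] at this

lemma index_le (H : IsFilteredAtInfinity k m l d P f ε c C R) {a b : ℕ} (hab : a ≤ b)
    (hb : b ≤ m) : l a ≤ l b := by
  induction b, hab using Nat.le_induction with
  | base => exact le_rfl
  | succ n hn ih => exact (ih (by lia)).trans (H.index_lt n hb).le

lemma degree_anti (H : IsFilteredAtInfinity k m l d P f ε c C R) {a b : ℕ} (ha : 1 ≤ a)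
    (hab : a ≤ b) (hb : b ≤ m) : d b ≤ d a := by
  induction b, hab using Nat.le_induction with
  | base => exact le_rfl
  | succ n hn ih => exact (H.degree_lt n (ha.trans hn) hb).le.trans (ih (by lia))

lemma sigmaSet_nonempty (H : IsFilteredAtInfinity k m l d P f ε c C R) {i : ℕ} (hi : 1 ≤ i)
    (him : i ≤ m) : (sigmaSet k P l i).Nonempty := by
  classical
  have hlt := H.index_pred_lt hi him
  have hk : l i ≤ k := H.last_index ▸ H.index_le him le_rfl
  have hzero : ∀ j : Fin k, (j : ℕ) < l (i - 1) → eval 0 (pPlus k P j) = 0 := by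
    intro j hj
    have hdeg := (H.two_le_degree i hi him).trans (H.le_degree i hi him j (hj.trans hlt))
    have := norm_eval_smul (pPlus_isHomogeneous P j) le_rfl 0
    rw [zero_pow (by lia), zero_mul, norm_eq_zero] at this
    have hfun : (fun t => ((0 : ℝ) • (0 : EuclideanSpace ℂ (Fin k))) t) = 0 := by
      funext t
      simp
    rwa [hfun] at this
  obtain ⟨w, hw0, hw⟩ := exists_ne_zero_eval_eq_zero
    (fun j : Fin k => if (j : ℕ) < l (i - 1) then pPlus k P j else
      if l i ≤ (j : ℕ) then X j else 0) ⟨l (i - 1), by lia⟩ (fun j _ => by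
        split_ifs with h1
        · exact hzero j h1
        · simp
        · simp)
  set v : EuclideanSpace ℂ (Fin k) := WithLp.toLp 2 w with hv
  have hv0 : 0 < ‖v‖ := by
    rw [norm_pos_iff]
    intro h
    exact hw0 (by simpa [hv] using h)
  have hvw : ∀ t, v t = w t := fun t => rfl
  refine ⟨‖v‖⁻¹ • v, by simp [norm_smul, hv0.ne'], fun j hj => ?_, fun j hj => ?_⟩
  · rw [← norm_eq_zero, norm_eval_smul (pPlus_isHomogeneous P j) (by positivity)]
    have := hw j (fun h => by simp [h] at hj)
    simp only [hj, if_true] at this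
    simp [hvw, this]
  · have hj' : ¬ (j : ℕ) < l (i - 1) := by lia
    have := hw j (fun h => by simp [h] at hj; lia)
    simp only [hj', hj, if_true, if_false, eval_X] at this
    simp [hvw, this]

lemma one_lt_norm (H : IsFilteredAtInfinity k m l d P f ε c C R) {a : ℕ}
    {z : EuclideanSpace ℂ (Fin k)} (hz : z ∈ infinityCone k ε R a) : 1 < ‖z‖ :=
  H.one_le_radius.trans_lt hz.1

lemma notMem_cone_zero (H : IsFilteredAtInfinity k m l d P f ε c C R)
    (z : EuclideanSpace ℂ (Fin k)) : z ∉ infinityCone k ε R (l 0) := fun hz => by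
  obtain ⟨j, hj, -⟩ := H.coercive 0 (Nat.zero_le m) z hz
  simp [H.zero_index] at hj

lemma mem_cone_last (H : IsFilteredAtInfinity k m l d P f ε c C R)
    {z : EuclideanSpace ℂ (Fin k)} : z ∈ infinityCone k ε R (l m) ↔ R < ‖z‖ := by
  refine ⟨fun h => h.1, fun h => ⟨h, fun j hj => ?_⟩⟩
  rw [H.last_index] at hj
  exact absurd j.2 (not_lt.2 hj)

lemma cone_mono (H : IsFilteredAtInfinity k m l d P f ε c C R) {a b : ℕ} (hab : a ≤ b)
    (hb : b ≤ m) : infinityCone k ε R (l a) ⊆ infinityCone k ε R (l b) := fun _ hz =>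
  ⟨hz.1, fun j hj => hz.2 j ((H.index_le hab hb).trans hj)⟩

lemma iterate_mem_cone (H : IsFilteredAtInfinity k m l d P f ε c C R) {i : ℕ} (hi : 1 ≤ i)
    (him : i ≤ m) {z : EuclideanSpace ℂ (Fin k)} {N n : ℕ} (hNn : N ≤ n)
    (hz : f^[N] z ∈ infinityCone k ε R (l i)) : f^[n] z ∈ infinityCone k ε R (l i) := by
  induction n, hNn using Nat.le_induction with
  | base => exact hz
  | succ n hn ih =>
    rw [Function.iterate_succ_apply']
    exact H.mapsTo i hi him ih

lemma tendsto_norm_iterate (H : IsFilteredAtInfinity k m l d P f ε c C R) {i : ℕ} (hi : 1 ≤ i)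
    (him : i ≤ m) {z : EuclideanSpace ℂ (Fin k)} {N : ℕ}
    (hz : f^[N] z ∈ infinityCone k ε R (l i)) :
    Tendsto (fun n => ‖f^[n] z‖) atTop atTop := by
  rw [← tendsto_add_atTop_iff_nat N]
  refine tendsto_atTop_mono (fun n => ?_) (tendsto_pow_atTop_atTop_of_one_lt one_lt_two)
  induction n with
  | zero => simpa using (H.one_lt_norm hz).le
  | succ n ih =>
    have := H.double i hi him _ (H.iterate_mem_cone hi him (Nat.le_add_left N n) hz)
    rw [show n + 1 + N = (n + N) + 1 by ring, Function.iterate_succ_apply', pow_succ]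
    linarith

/-- The open set of points whose orbit enters the `i`-th cone at infinity. -/
def enters (k : ℕ) (l : ℕ → ℕ) (f : EuclideanSpace ℂ (Fin k) → EuclideanSpace ℂ (Fin k))
    (ε R : ℝ) (i : ℕ) : Set (EuclideanSpace ℂ (Fin k)) :=
  {z | ∃ n, f^[n] z ∈ infinityCone k ε R (l i)}

lemma isOpen_enters (H : IsFilteredAtInfinity k m l d P f ε c C R) (i : ℕ) :
    IsOpen (enters k l f ε R i) := by
  have : enters k l f ε R i = ⋃ n, f^[n] ⁻¹' infinityCone k ε R (l i) := by
    ext z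
    simp [enters]
  rw [this]
  exact isOpen_iUnion fun n => (isOpen_infinityCone k ε R (l i)).preimage (H.cont.iterate n)

lemma enters_mono (H : IsFilteredAtInfinity k m l d P f ε c C R) {a b : ℕ} (hab : a ≤ b)
    (hb : b ≤ m) : enters k l f ε R a ⊆ enters k l f ε R b :=
  fun _ ⟨n, hn⟩ => ⟨n, H.cone_mono hab hb hn⟩

lemma enters_zero (H : IsFilteredAtInfinity k m l d P f ε c C R) : enters k l f ε R 0 = ∅ :=
  eq_empty_of_forall_notMem fun _ ⟨_, hn⟩ => H.notMem_cone_zero _ hn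

lemma notMem_enters_last_iff (H : IsFilteredAtInfinity k m l d P f ε c C R) (hm : 1 ≤ m)
    (z : EuclideanSpace ℂ (Fin k)) :
    z ∉ enters k l f ε R m ↔ ∃ B : ℝ, ∀ n : ℕ, ‖f^[n] z‖ ≤ B := by
  constructor
  · intro h
    refine ⟨R, fun n => ?_⟩
    by_contra! hn
    exact h ⟨n, H.mem_cone_last.2 hn⟩
  · rintro ⟨B, hB⟩ ⟨n, hn⟩
    obtain ⟨q, hq⟩ := ((H.tendsto_norm_iterate hm le_rfl hn).eventually_gt_atTop B).exists
    exact absurd (hB q) (not_le.2 hq)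

lemma isCompact_compl_enters_last (H : IsFilteredAtInfinity k m l d P f ε c C R) :
    IsCompact (enters k l f ε R m)ᶜ := by
  refine (isCompact_closedBall (0 : EuclideanSpace ℂ (Fin k)) R).of_isClosed_subset
    (H.isOpen_enters m).isClosed_compl fun z hz => ?_
  rw [mem_closedBall_zero_iff]
  by_contra! hn
  exact hz ⟨0, H.mem_cone_last.2 hn⟩

lemma eventually_direction_mem_sphere {z : EuclideanSpace ℂ (Fin k)}
    (h : Tendsto (fun n => ‖f^[n] z‖) atTop atTop) :
    ∀ᶠ n in atTop, ‖f^[n] z‖⁻¹ • f^[n] z ∈ sphere (0 : EuclideanSpace ℂ (Fin k)) 1 := by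
  filter_upwards [h.eventually_gt_atTop 0] with n hn
  simp [norm_smul, hn.ne']

lemma mem_basin_iff (H : IsFilteredAtInfinity k m l d P f ε c C R) {i : ℕ} (hi : 1 ≤ i)
    (him : i ≤ m) {z : EuclideanSpace ℂ (Fin k)} :
    z ∈ basin k f P l i ↔ Tendsto (fun n => ‖f^[n] z‖) atTop atTop ∧
      Tendsto (fun n => sigmaDefect k P l i (‖f^[n] z‖⁻¹ • f^[n] z)) atTop (𝓝 0) :=
  and_congr_right fun h => tendsto_infDist_sigmaSet_iff (H.index_pred_lt hi him).le
    (H.sigmaSet_nonempty hi him) (eventually_direction_mem_sphere h)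

lemma basin_subset (H : IsFilteredAtInfinity k m l d P f ε c C R) {i : ℕ} (hi : 1 ≤ i)
    (him : i ≤ m) :
    basin k f P l i ⊆ enters k l f ε R i \ enters k l f ε R (i - 1) := by
  intro z hz
  obtain ⟨hinf, hdef⟩ := (H.mem_basin_iff hi him).1 hz
  have hlt := H.index_pred_lt hi him
  have hsmall := (hdef.eventually_lt_const H.eps_pos).and (hinf.eventually_gt_atTop (max R 0))
  constructor
  · obtain ⟨n, h1, h2⟩ := hsmall.exists
    have hpos : 0 < ‖f^[n] z‖ := (le_max_right _ _).trans_lt h2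
    refine ⟨n, (le_max_left _ _).trans_lt h2, fun j hj => ?_⟩
    have := (norm_apply_le_sigmaDefect hlt.le hj _).trans_lt h1
    rwa [PiLp.smul_apply, norm_smul, norm_inv, norm_norm, inv_mul_eq_div,
      div_lt_iff₀ hpos] at this
  · rintro ⟨N, hN⟩
    have hi1 : 1 ≤ i - 1 := by
      by_contra! h0
      rw [Nat.lt_one_iff.1 h0] at hN
      exact H.notMem_cone_zero _ hN
    obtain ⟨n, ⟨h1, h2⟩, hn⟩ := (hsmall.and (eventually_ge_atTop N)).exists
    have hpos : 0 < ‖f^[n] z‖ := (le_max_right _ _).trans_lt h2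
    obtain ⟨j, hj, hle⟩ := H.coercive (i - 1) (by lia) _
      (H.iterate_mem_cone hi1 (by lia) hn hN)
    have := (norm_eval_le_sigmaDefect hj _).trans_lt h1
    rw [norm_eval_smul (pPlus_isHomogeneous P j) (by positivity), inv_pow, inv_mul_eq_div,
      div_lt_iff₀ (by positivity)] at this
    linarith

/-- Points that stay out of a smaller cone have controlled growth. -/
lemma norm_le_of_notMem_cone (H : IsFilteredAtInfinity k m l d P f ε c C R) {i : ℕ} (hi : 1 ≤ i)
    (him : i ≤ m) {z : EuclideanSpace ℂ (Fin k)} (hz : 1 ≤ ‖z‖) (hfz : R < ‖f z‖)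
    (hnot : f z ∉ infinityCone k ε R (l (i - 1))) : ‖f z‖ ≤ C / ε * ‖z‖ ^ d i := by
  have : ∃ j : Fin k, l (i - 1) ≤ (j : ℕ) ∧ ε * ‖f z‖ ≤ ‖f z j‖ := by
    by_contra! h
    exact hnot ⟨hfz, h⟩
  obtain ⟨j, hj, hle⟩ := this
  rw [div_mul_eq_mul_div, le_div_iff₀ H.eps_pos, mul_comm]
  refine hle.trans ((H.norm_apply_le z hz j).trans ?_)
  have := H.bound_nonneg
  gcongr
  · exact H.degree_le i hi him j hj

lemma eventually_norm_le (H : IsFilteredAtInfinity k m l d P f ε c C R) {i : ℕ} (hi : 1 ≤ i)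
    (him : i ≤ m) {z : EuclideanSpace ℂ (Fin k)}
    (hz : z ∈ enters k l f ε R i \ enters k l f ε R (i - 1)) :
    ∀ᶠ n in atTop, ‖f^[n + 1] z‖ ≤ C / ε * ‖f^[n] z‖ ^ d i := by
  obtain ⟨⟨N, hN⟩, hnot⟩ := hz
  filter_upwards [eventually_ge_atTop N] with n hn
  have hmem := H.iterate_mem_cone hi him hn hN
  rw [Function.iterate_succ_apply']
  refine H.norm_le_of_notMem_cone hi him (H.one_lt_norm hmem).le (H.mapsTo i hi him hmem).1 ?_
  rw [← Function.iterate_succ_apply' f]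
  exact fun h => hnot ⟨_, h⟩

lemma tendsto_growth (H : IsFilteredAtInfinity k m l d P f ε c C R) {i : ℕ} (hi : 1 ≤ i)
    (him : i ≤ m) {z : EuclideanSpace ℂ (Fin k)}
    (hz : z ∈ enters k l f ε R i \ enters k l f ε R (i - 1)) :
    Tendsto (fun n : ℕ => (n : ℝ)⁻¹ * logPlus (logPlus ‖f^[n] z‖)) atTop
      (𝓝 (Real.log (d i))) := by
  have hup := H.eventually_norm_le hi him hz
  obtain ⟨⟨N, hN⟩, hnot⟩ := hz
  refine tendsto_inv_mul_logPlus_of_comparable (H.tendsto_norm_iterate hi him hN) H.const_pos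
    (one_le_two.trans (H.two_le_degree i hi him)) ?_ hup
  filter_upwards [eventually_ge_atTop N] with n hn
  rw [Function.iterate_succ_apply']
  exact H.growth i hi him _ (H.iterate_mem_cone hi him hn hN)

lemma tendsto_eval_direction (H : IsFilteredAtInfinity k m l d P f ε c C R) {i : ℕ} (hi : 1 ≤ i)
    (him : i ≤ m) {z : EuclideanSpace ℂ (Fin k)}
    (hz : z ∈ enters k l f ε R i \ enters k l f ε R (i - 1)) {j : Fin k}
    (hj : (j : ℕ) < l (i - 1)) :
    Tendsto (fun n => ‖eval (fun t => (‖f^[n] z‖⁻¹ • f^[n] z) t) (pPlus k P j)‖) atTop (𝓝 0) := by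
  have hup := H.eventually_norm_le hi him hz
  obtain ⟨⟨N, hN⟩, hnot⟩ := hz
  have hinf := H.tendsto_norm_iterate hi him hN
  have hi1 : 1 ≤ i - 1 := by
    by_contra! h0
    rw [Nat.lt_one_iff.1 h0, H.zero_index] at hj
    exact absurd hj (Nat.not_lt_zero _)
  have hdeg : d i + 1 ≤ (P j).totalDegree := by
    have h1 := H.le_degree (i - 1) hi1 (by lia) j hj
    have h2 := H.degree_lt (i - 1) hi1 (by lia)
    rw [Nat.sub_add_cancel hi] at h2
    lia
  refine squeeze_zero' (Eventually.of_forall fun n => norm_nonneg _) ?_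
    ((tendsto_const_nhds (x := C / ε + C)).div_atTop hinf)
  filter_upwards [hup, hinf.eventually_ge_atTop 1] with n h1 h2
  have hpos : 0 < ‖f^[n] z‖ := by linarith
  rw [norm_eval_smul (pPlus_isHomogeneous P j) (by positivity), inv_pow, inv_mul_eq_div,
    div_le_div_iff₀ (by positivity) hpos]
  rw [Function.iterate_succ_apply'] at h1
  set x := f^[n] z
  have h3 := H.norm_sub_le x h2 j
  have h4 := norm_le_norm_sub_add (eval (fun t => x t) (pPlus k P j)) (f x j)
  rw [norm_sub_rev] at h4
  have h5 : ‖f x j‖ * ‖x‖ ≤ C / ε * ‖x‖ ^ (P j).totalDegree := by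
    have := H.bound_nonneg
    have := H.eps_pos
    calc ‖f x j‖ * ‖x‖ ≤ (C / ε * ‖x‖ ^ d i) * ‖x‖ := by
          gcongr
          exact (PiLp.norm_apply_le _ _).trans h1
      _ = C / ε * ‖x‖ ^ (d i + 1) := by ring
      _ ≤ _ := by gcongr
  calc _ ≤ (‖f x j - eval (fun t => x t) (pPlus k P j)‖ + ‖f x j‖) * ‖x‖ := by gcongr
    _ ≤ _ := by linarith

lemma tendsto_apply_direction (H : IsFilteredAtInfinity k m l d P f ε c C R) {i : ℕ}
    (hi : 1 ≤ i) (him : i ≤ m) {z : EuclideanSpace ℂ (Fin k)}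
    (hz : z ∈ enters k l f ε R i) {j : Fin k} (hj : l i ≤ (j : ℕ)) :
    Tendsto (fun n => ‖(‖f^[n] z‖⁻¹ • f^[n] z) j‖) atTop (𝓝 0) := by
  obtain ⟨N, hN⟩ := hz
  have hinf := H.tendsto_norm_iterate hi him hN
  have hilt : i < m := by
    refine lt_of_le_of_ne him ?_
    rintro rfl
    rw [H.last_index] at hj
    exact absurd j.2 (not_lt.2 hj)
  have hdeg : (P j).totalDegree + 1 ≤ d i :=
    (Nat.succ_le_succ (H.degree_le (i + 1) (by lia) hilt j hj)).trans (H.degree_lt i hi hilt)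
  rw [← tendsto_add_atTop_iff_nat 1]
  refine squeeze_zero' (Eventually.of_forall fun n => norm_nonneg _) ?_
    ((tendsto_const_nhds (x := C / c)).div_atTop hinf)
  filter_upwards [eventually_ge_atTop N] with n hn
  have hmem := H.iterate_mem_cone hi him hn hN
  rw [Function.iterate_succ_apply']
  set x := f^[n] z
  have hx1 := H.one_lt_norm hmem
  have hfx1 := H.one_lt_norm (H.mapsTo i hi him hmem)
  have hc := H.const_pos
  have hC := H.bound_nonneg
  rw [PiLp.smul_apply, norm_smul, norm_inv, norm_norm, inv_mul_eq_div,
    div_le_div_iff₀ (by positivity) (by positivity), div_mul_eq_mul_div, le_div_iff₀ hc]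
  have h1 := H.norm_apply_le x hx1.le j
  have h2 := H.growth i hi him x hmem
  calc ‖f x j‖ * ‖x‖ * c ≤ C * ‖x‖ ^ (P j).totalDegree * ‖x‖ * c := by gcongr
    _ = C * (c * ‖x‖ ^ ((P j).totalDegree + 1)) := by ring
    _ ≤ C * (c * ‖x‖ ^ d i) := by gcongr; exact hx1.le
    _ ≤ C * ‖f x‖ := by gcongr

lemma basin_eq (H : IsFilteredAtInfinity k m l d P f ε c C R) {i : ℕ} (hi : 1 ≤ i)
    (him : i ≤ m) :
    basin k f P l i = enters k l f ε R i \ enters k l f ε R (i - 1) := by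
  refine (H.basin_subset hi him).antisymm fun z hz => ?_
  have hinf : Tendsto (fun n => ‖f^[n] z‖) atTop atTop :=
    H.tendsto_norm_iterate hi him hz.1.choose_spec
  refine (H.mem_basin_iff hi him).2 ⟨hinf, ?_⟩
  rw [← Finset.sum_const_zero (s := (Finset.univ : Finset (Fin k)))]
  refine tendsto_finsetSum _ fun j _ => ?_
  split_ifs with h1 h2
  · exact H.tendsto_eval_direction hi him hz h1
  · exact H.tendsto_apply_direction hi him hz.1 h2
  · exact tendsto_const_nhds

lemma exists_mem_basin (H : IsFilteredAtInfinity k m l d P f ε c C R) {i : ℕ} (him : i ≤ m)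
    {z : EuclideanSpace ℂ (Fin k)} (hz : z ∈ enters k l f ε R i) :
    ∃ j, 1 ≤ j ∧ j ≤ i ∧ z ∈ basin k f P l j := by
  induction i with
  | zero => simp [H.enters_zero] at hz
  | succ i ih =>
    by_cases h : z ∈ enters k l f ε R i
    · obtain ⟨j, h1, h2, h3⟩ := ih (by lia) h
      exact ⟨j, h1, by lia, h3⟩
    · refine ⟨i + 1, by lia, le_rfl, ?_⟩
      rw [H.basin_eq (by lia) him]
      exact ⟨hz, h⟩

lemma biUnion_basin (H : IsFilteredAtInfinity k m l d P f ε c C R) {i : ℕ} (him : i ≤ m) :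
    ⋃ j ∈ Finset.Icc 1 i, basin k f P l j = enters k l f ε R i := by
  ext z
  simp only [mem_iUnion, Finset.mem_Icc, exists_prop]
  constructor
  · rintro ⟨j, ⟨h1, h2⟩, h3⟩
    exact H.enters_mono h2 him (H.basin_subset h1 (h2.trans him) h3).1
  · intro hz
    obtain ⟨j, h1, h2, h3⟩ := H.exists_mem_basin him hz
    exact ⟨j, ⟨h1, h2⟩, h3⟩

lemma disjoint_basin (H : IsFilteredAtInfinity k m l d P f ε c C R) {i j : ℕ} (hi : 1 ≤ i)
    (hij : i < j) (hj : j ≤ m) : Disjoint (basin k f P l i) (basin k f P l j) := by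
  refine Set.disjoint_left.2 fun z h1 h2 => ?_
  refine (H.basin_subset (by lia) hj h2).2 (H.enters_mono (by lia) (by lia)
    (H.basin_subset hi (by lia) h1).1)

end IsFilteredAtInfinity

/-- For a proper regular map with `d_m ≥ 2`: `ℂ^k` is the disjoint
union of the set `K` of bounded orbits and the basins `U_1, …, U_m` (so `K = K_m`);
`K` is compact; each `U_1 ∪ ⋯ ∪ U_i` is open; and the escape-rate function
`α̃(z) = lim (1/n)·log⁺log⁺‖f^n(z)‖` exists everywhere, equals `log d_i` on `U_i` and
`0` on `K`, takes only these `m+1` values, and is lower semicontinuous. -/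
theorem stmt9 (k m : ℕ) (hk : 0 < k) (hm : 1 ≤ m)
    (l : ℕ → ℕ) (hl0 : l 0 = 0) (hlm : l m = k)
    (hlmono : ∀ i < m, l i < l (i + 1))
    (P : Fin k → MvPolynomial (Fin k) ℂ)
    (d : ℕ → ℕ)
    (hdeg : ∀ i, 1 ≤ i → i ≤ m → ∀ j : Fin k,
      l (i - 1) ≤ (j : ℕ) → (j : ℕ) < l i → (P j).totalDegree = d i)
    (hdmono : ∀ i, 1 ≤ i → i < m → d (i + 1) < d i)
    (hdm : 1 ≤ d m)
    (f : EuclideanSpace ℂ (Fin k) → EuclideanSpace ℂ (Fin k))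
    (hf : ∀ (z : EuclideanSpace ℂ (Fin k)) (j : Fin k),
      f z j = eval (fun t => z t) (P j))
    (hproper : IsProperMap f)
    (hreg : ∀ r, 1 ≤ r → r ≤ m → ∀ z : Fin k → ℂ,
      (∀ j : Fin k, (j : ℕ) < l r → eval z (pPlus k P j) = 0) →
      (∀ j : Fin k, l r ≤ (j : ℕ) → z j = 0) → z = 0)
    (hdm2 : 2 ≤ d m)
    (K : Set (EuclideanSpace ℂ (Fin k)))
    (hK : K = {z | ∃ C : ℝ, ∀ n : ℕ, ‖f^[n] z‖ ≤ C}) :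
    (∀ z : EuclideanSpace ℂ (Fin k),
      z ∈ K ∨ ∃ i, 1 ≤ i ∧ i ≤ m ∧ z ∈ basin k f P l i) ∧
    (∀ i, 1 ≤ i → i ≤ m → Disjoint (basin k f P l i) K) ∧
    (∀ i j, 1 ≤ i → i < j → j ≤ m → Disjoint (basin k f P l i) (basin k f P l j)) ∧
    K = kSet k f P l m ∧
    IsCompact K ∧
    (∀ i, 1 ≤ i → i ≤ m → IsOpen (⋃ j ∈ Finset.Icc 1 i, basin k f P l j)) ∧
    ∃ A : EuclideanSpace ℂ (Fin k) → ℝ,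
      (∀ z, Tendsto (fun n : ℕ => (n : ℝ)⁻¹ * logPlus (logPlus ‖f^[n] z‖)) atTop
        (𝓝 (A z))) ∧
      (∀ z ∈ K, A z = 0) ∧
      (∀ i, 1 ≤ i → i ≤ m → ∀ z ∈ basin k f P l i, A z = Real.log (d i)) ∧
      LowerSemicontinuous A ∧
      (∀ z, A z = 0 ∨ ∃ i, 1 ≤ i ∧ i ≤ m ∧ A z = Real.log (d i)) := by
  obtain ⟨ε, c, C, R, H⟩ := exists_isFilteredAtInfinity hk hl0 hlm hlmono hdeg hdmono hf
    hproper.continuous hreg hdm2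
  have hKeq : K = (IsFilteredAtInfinity.enters k l f ε R m)ᶜ := by
    ext z
    rw [hK, mem_compl_iff, H.notMem_enters_last_iff hm]
    rfl
  have hcover : ∀ z, z ∈ K ∨ ∃ i, 1 ≤ i ∧ i ≤ m ∧ z ∈ basin k f P l i := fun z => by
    by_cases h : z ∈ IsFilteredAtInfinity.enters k l f ε R m
    · exact Or.inr (H.exists_mem_basin le_rfl h)
    · exact Or.inl (hKeq ▸ h)
  have hdisj : ∀ i, 1 ≤ i → i ≤ m → Disjoint (basin k f P l i) K := fun i hi him => by
    rw [hKeq, disjoint_compl_right_iff_subset]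
    exact fun z hz => H.enters_mono him le_rfl (H.basin_subset hi him hz).1
  have hlimK : ∀ z ∈ K,
      Tendsto (fun n : ℕ => (n : ℝ)⁻¹ * logPlus (logPlus ‖f^[n] z‖)) atTop (𝓝 0) := by
    intro z hz
    rw [hK] at hz
    obtain ⟨B, hB⟩ := hz
    exact tendsto_inv_mul_logPlus_of_bounded (fun n => norm_nonneg _) hB
  have hlimU : ∀ i, 1 ≤ i → i ≤ m → ∀ z ∈ basin k f P l i,
      Tendsto (fun n : ℕ => (n : ℝ)⁻¹ * logPlus (logPlus ‖f^[n] z‖)) atTop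
        (𝓝 (Real.log (d i))) := fun i hi him z hz =>
    H.tendsto_growth hi him (H.basin_subset hi him hz)
  have hex : ∀ z, ∃ a, Tendsto (fun n : ℕ => (n : ℝ)⁻¹ * logPlus (logPlus ‖f^[n] z‖)) atTop
      (𝓝 a) := fun z => by
    rcases hcover z with h | ⟨i, hi, him, h⟩
    · exact ⟨0, hlimK z h⟩
    · exact ⟨_, hlimU i hi him z h⟩
  choose A hA using hex
  have hAK : ∀ z ∈ K, A z = 0 := fun z hz => tendsto_nhds_unique (hA z) (hlimK z hz)
  have hAU : ∀ i, 1 ≤ i → i ≤ m → ∀ z ∈ basin k f P l i, A z = Real.log (d i) :=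
    fun i hi him z hz => tendsto_nhds_unique (hA z) (hlimU i hi him z hz)
  refine ⟨hcover, hdisj, fun i j hi hij hj => H.disjoint_basin hi hij hj, ?_,
    hKeq ▸ H.isCompact_compl_enters_last, fun i hi him => ?_, A, hA, hAK, hAU, ?_, fun z => ?_⟩
  · ext z
    constructor
    · exact fun hz j hj hjm hzj => Set.disjoint_left.1 (hdisj j hj hjm) hzj hz
    · intro hz
      rcases hcover z with h | ⟨i, hi, him, h⟩
      · exact h
      · exact absurd h (hz i hi him)
  · rw [H.biUnion_basin him]
    exact H.isOpen_enters i
  · intro z y hy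
    rcases hcover z with h | ⟨i, hi, him, h⟩
    · rw [hAK z h] at hy
      refine Eventually.of_forall fun x => hy.trans_le ?_
      exact ge_of_tendsto' (hA x) fun n => mul_nonneg (by positivity) (logPlus_nonneg _)
    · rw [hAU i hi him z h] at hy
      filter_upwards [(H.isOpen_enters i).mem_nhds (H.basin_subset hi him h).1] with x hx
      obtain ⟨j, hj, hji, hxj⟩ := H.exists_mem_basin him hx
      rw [hAU j hj (hji.trans him) x hxj]
      refine hy.trans_le (Real.log_le_log ?_ ?_)
      · have := H.two_le_degree i hi him
        positivity
      · exact_mod_cast H.degree_anti hj hji him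
  · rcases hcover z with h | ⟨i, hi, him, h⟩
    · exact Or.inl (hAK z h)
    · exact Or.inr ⟨i, hi, him, hAU i hi him z h⟩
end

section
/- Assume f is π-regular for some π(z) = (z_1^{p_1}, z_2^{p_2}) with p_1 ≤ p_2 positive integers. Then σ < 0 and {z ∈ ℂ² : P_1^{D_1}(z) = P_2^{D_2}(z) = 0} = {0}. -/
open MvPolynomial Classical

noncomputable section

/-- The slope `σ`: the minimum of `n/(m − d₁)` over the pairs `(m,n) ≠ (d₁,0)` in the
supports of `P₁` and `P₂`. -/
def slopeSigma (P1 P2 : MvPolynomial (Fin 2) ℂ) (d1 : ℕ) : ℝ :=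
  sInf {x : ℝ | ∃ s : Fin 2 →₀ ℕ, (s ∈ P1.support ∨ s ∈ P2.support) ∧
    ¬(s 0 = d1 ∧ s 1 = 0) ∧ x = (s 1 : ℝ) / ((s 0 : ℝ) - (d1 : ℝ))}

/-- The truncation `P^D` of `P` to the line `D = {(x,y) : y − σ·x = b}`: the sum of
the monomials `c_{mn} z₁^m z₂^n` of `P` with `(m,n) ∈ D`. -/
def lineTrunc (P : MvPolynomial (Fin 2) ℂ) (σ b : ℝ) : MvPolynomial (Fin 2) ℂ :=
  ∑ s ∈ P.support.filter (fun s => (s 1 : ℝ) - σ * (s 0 : ℝ) = b),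
    monomial s (coeff s P)

/-- The height of the supporting line `D₂` of slope `σ` of the Newton polygon of
`P₂` (so that `D₂` has `Σ₂` on or below it and meets `Σ₂`). -/
def bD2 (P2 : MvPolynomial (Fin 2) ℂ) (σ : ℝ) : ℝ :=
  sSup {x : ℝ | ∃ s ∈ P2.support, x = (s 1 : ℝ) - σ * (s 0 : ℝ)}

/-- `(Q₁, Q₂)` is a regular polynomial map of `ℂ²`: `deg Q₁ ≥ deg Q₂ ≥ 1`, the top
homogeneous parts have no common zero but `0`, and if `deg Q₁ > deg Q₂` the
coefficient of `z₁^{deg Q₁}` in `Q₁` is nonzero. -/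
def Regular2 (Q1 Q2 : MvPolynomial (Fin 2) ℂ) : Prop :=
  Q2.totalDegree ≤ Q1.totalDegree ∧ 1 ≤ Q2.totalDegree ∧
  {z : Fin 2 → ℂ | eval z (homogeneousComponent Q1.totalDegree Q1) = 0 ∧
    eval z (homogeneousComponent Q2.totalDegree Q2) = 0} = {0} ∧
  (Q2.totalDegree < Q1.totalDegree →
    coeff (Finsupp.single (0 : Fin 2) Q1.totalDegree) Q1 ≠ 0)

end

/-- The exponent of the monomial `z ^ s` after substituting `(z₁ ^ p1, z₂ ^ p2)`. -/
noncomputable def dilate (p1 p2 : ℕ) (s : Fin 2 →₀ ℕ) : Fin 2 →₀ ℕ :=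
  Finsupp.single 0 (p1 * s 0) + Finsupp.single 1 (p2 * s 1)

@[simp] lemma dilate_zero (p1 p2 : ℕ) (s : Fin 2 →₀ ℕ) : dilate p1 p2 s 0 = p1 * s 0 := by
  simp [dilate]

@[simp] lemma dilate_one (p1 p2 : ℕ) (s : Fin 2 →₀ ℕ) : dilate p1 p2 s 1 = p2 * s 1 := by
  simp [dilate]

lemma degree_dilate (p1 p2 : ℕ) (s : Fin 2 →₀ ℕ) :
    (dilate p1 p2 s).degree = p1 * s 0 + p2 * s 1 := by
  simp [Finsupp.degree_eq_sum, Fin.sum_univ_two]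

lemma dilate_injective {p1 p2 : ℕ} (hp1 : 0 < p1) (hp2 : 0 < p2) :
    Function.Injective (dilate p1 p2) := by
  intro s t h
  have h0 := DFunLike.congr_fun h 0
  have h1 := DFunLike.congr_fun h 1
  simp only [dilate_zero, dilate_one] at h0 h1
  ext i
  fin_cases i
  · exact Nat.eq_of_mul_eq_mul_left hp1 h0
  · exact Nat.eq_of_mul_eq_mul_left hp2 h1

lemma eval_monomial_fin_two (z : Fin 2 → ℂ) (s : Fin 2 →₀ ℕ) (c : ℂ) :
    eval z (monomial s c) = c * (z 0 ^ s 0 * z 1 ^ s 1) := by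
  rw [eval_monomial, Finsupp.prod_fintype _ _ (by simp), Fin.prod_univ_two]

lemma aeval_pow_eq_sum (P : MvPolynomial (Fin 2) ℂ) (p1 p2 : ℕ) :
    aeval ![X 0 ^ p1, (X 1 ^ p2 : MvPolynomial (Fin 2) ℂ)] P =
      ∑ s ∈ P.support, monomial (dilate p1 p2 s) (coeff s P) := by
  rw [aeval_def, eval₂_eq']
  refine Finset.sum_congr rfl fun s _ => ?_
  have h : (monomial (dilate p1 p2 s) (coeff s P) : MvPolynomial (Fin 2) ℂ) =
      monomial (Finsupp.single 0 (p1 * s 0)) (coeff s P) *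
        monomial (Finsupp.single 1 (p2 * s 1)) 1 := by
    rw [monomial_mul, mul_one, dilate]
  rw [h, ← C_mul_X_pow_eq_monomial, ← X_pow_eq_monomial, Fin.prod_univ_two]
  simp [pow_mul, mul_assoc, algebraMap_eq]

lemma coeff_aeval_pow_dilate (P : MvPolynomial (Fin 2) ℂ) {p1 p2 : ℕ} (hp1 : 0 < p1)
    (hp2 : 0 < p2) (s : Fin 2 →₀ ℕ) :
    coeff (dilate p1 p2 s) (aeval ![X 0 ^ p1, (X 1 ^ p2 : MvPolynomial (Fin 2) ℂ)] P) =
      coeff s P := by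
  simp only [aeval_pow_eq_sum, coeff_sum, coeff_monomial, (dilate_injective hp1 hp2).eq_iff]
  simp only [Finset.sum_ite_eq', mem_support_iff, ite_not]
  split_ifs with h <;> simp_all

lemma exists_dilate_eq_of_coeff_ne_zero {P : MvPolynomial (Fin 2) ℂ} {p1 p2 : ℕ}
    {t : Fin 2 →₀ ℕ}
    (h : coeff t (aeval ![X 0 ^ p1, (X 1 ^ p2 : MvPolynomial (Fin 2) ℂ)] P) ≠ 0) :
    ∃ s ∈ P.support, dilate p1 p2 s = t := by
  rw [aeval_pow_eq_sum, coeff_sum] at h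
  obtain ⟨s, hs, hne⟩ := Finset.exists_ne_zero_of_sum_ne_zero h
  rw [coeff_monomial] at hne
  exact ⟨s, hs, by_contra fun hst => hne (if_neg hst)⟩

lemma weight_le_totalDegree {P : MvPolynomial (Fin 2) ℂ} {p1 p2 : ℕ} (hp1 : 0 < p1)
    (hp2 : 0 < p2) {s : Fin 2 →₀ ℕ} (hs : s ∈ P.support) :
    p1 * s 0 + p2 * s 1 ≤
      (aeval ![X 0 ^ p1, (X 1 ^ p2 : MvPolynomial (Fin 2) ℂ)] P).totalDegree := by
  rw [← degree_dilate]
  refine le_totalDegree ?_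
  rw [mem_support_iff, coeff_aeval_pow_dilate P hp1 hp2]
  exact mem_support_iff.mp hs

lemma exists_weight_eq_totalDegree {P : MvPolynomial (Fin 2) ℂ} (hP : P ≠ 0) {p1 p2 : ℕ}
    (hp1 : 0 < p1) (hp2 : 0 < p2) :
    ∃ s ∈ P.support, p1 * s 0 + p2 * s 1 =
      (aeval ![X 0 ^ p1, (X 1 ^ p2 : MvPolynomial (Fin 2) ℂ)] P).totalDegree := by
  set Q := aeval ![X 0 ^ p1, (X 1 ^ p2 : MvPolynomial (Fin 2) ℂ)] P
  obtain ⟨s₀, hs₀⟩ := support_nonempty.mpr hP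
  have hne : Q.support.Nonempty :=
    ⟨dilate p1 p2 s₀, by
      rw [mem_support_iff, coeff_aeval_pow_dilate P hp1 hp2]; exact mem_support_iff.mp hs₀⟩
  obtain ⟨t, ht, hdeg⟩ := Finset.exists_mem_eq_sup Q.support hne Finsupp.degree
  obtain ⟨s, hs, rfl⟩ := exists_dilate_eq_of_coeff_ne_zero (mem_support_iff.mp ht)
  exact ⟨s, hs, by rw [← degree_dilate, ← hdeg]; rfl⟩

lemma eval_homogeneousComponent_aeval_pow (P : MvPolynomial (Fin 2) ℂ) (p1 p2 N : ℕ)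
    (w : Fin 2 → ℂ) :
    eval w (homogeneousComponent N
        (aeval ![X 0 ^ p1, (X 1 ^ p2 : MvPolynomial (Fin 2) ℂ)] P)) =
      ∑ s ∈ P.support.filter (fun s => p1 * s 0 + p2 * s 1 = N),
        coeff s P * ((w 0 ^ p1) ^ s 0 * (w 1 ^ p2) ^ s 1) := by
  rw [aeval_pow_eq_sum, map_sum, map_sum, Finset.sum_filter]
  refine Finset.sum_congr rfl fun s _ => ?_
  rw [homogeneousComponent_of_mem
    ((mem_homogeneousSubmodule _ _).mpr (isHomogeneous_monomial _ (degree_dilate p1 p2 s)))]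
  simp only [eq_comm (a := N)]
  split_ifs <;> simp [eval_monomial_fin_two, pow_mul]

lemma eval_lineTrunc (P : MvPolynomial (Fin 2) ℂ) (σ b : ℝ) (z : Fin 2 → ℂ) :
    eval z (lineTrunc P σ b) =
      ∑ s ∈ P.support.filter (fun s => (s 1 : ℝ) - σ * (s 0 : ℝ) = b),
        coeff s P * (z 0 ^ s 0 * z 1 ^ s 1) := by
  simp only [lineTrunc, map_sum, eval_monomial_fin_two]

lemma bD2_eq {P : MvPolynomial (Fin 2) ℂ} {σ b : ℝ}
    (hle : ∀ s ∈ P.support, (s 1 : ℝ) - σ * (s 0 : ℝ) ≤ b)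
    {s : Fin 2 →₀ ℕ} (hs : s ∈ P.support) (hsb : (s 1 : ℝ) - σ * (s 0 : ℝ) = b) :
    bD2 P σ = b :=
  IsGreatest.csSup_eq ⟨⟨s, hs, hsb.symm⟩, by rintro _ ⟨t, ht, rfl⟩; exact hle t ht⟩

/-- If `σ = -p1/p2`, truncating to a line of slope `σ` is taking a weighted homogeneous part. -/
lemma eval_lineTrunc_eq_eval_homogeneousComponent (P : MvPolynomial (Fin 2) ℂ) {p1 p2 : ℕ}
    (hp2 : 0 < p2) {N : ℕ} {σ b : ℝ} (hσ : σ = -(p1 / p2 : ℝ)) (hb : b = N / p2)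
    (w z : Fin 2 → ℂ) (hz0 : w 0 ^ p1 = z 0) (hz1 : w 1 ^ p2 = z 1) :
    eval z (lineTrunc P σ b) = eval w (homogeneousComponent N
      (aeval ![X 0 ^ p1, (X 1 ^ p2 : MvPolynomial (Fin 2) ℂ)] P)) := by
  rw [eval_lineTrunc, eval_homogeneousComponent_aeval_pow, hz0, hz1]
  congr 1
  refine Finset.filter_congr fun s _ => ?_
  have hp2' : (p2 : ℝ) ≠ 0 := by positivity
  rw [← Nat.cast_inj (R := ℝ), hσ, hb]
  push_cast
  field_simp
  constructor <;> intro h <;> linarith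

lemma fin_two_ext {s : Fin 2 →₀ ℕ} {m n : ℕ} (h0 : s 0 = m) (h1 : s 1 = n) :
    s = Finsupp.single 0 m + Finsupp.single 1 n := by
  ext i
  fin_cases i <;> simp [h0, h1]

lemma add_le_of_totalDegree_le {P : MvPolynomial (Fin 2) ℂ} {d : ℕ} (hP : P.totalDegree ≤ d)
    {s : Fin 2 →₀ ℕ} (hs : s ∈ P.support) : s 0 + s 1 ≤ d := by
  have h : s.degree ≤ P.totalDegree := le_totalDegree hs
  rw [Finsupp.degree_eq_sum, Fin.sum_univ_two] at h
  omega

/-- For a regular map, the weighted degree of `P1` is attained at the vertex `(d1, 0)`. -/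
lemma totalDegree_aeval_pow_eq {P1 P2 : MvPolynomial (Fin 2) ℂ} {d1 p1 p2 : ℕ}
    (hd1 : P1.totalDegree ≤ d1) (hd2 : P2.totalDegree ≤ d1)
    (hstable : coeff (Finsupp.single (0 : Fin 2) d1) P1 ≠ 0)
    (hp1 : 0 < p1) (hp2 : 0 < p2)
    (hreg : Regular2 (aeval ![X 0 ^ p1, (X 1 ^ p2 : MvPolynomial (Fin 2) ℂ)] P1)
      (aeval ![X 0 ^ p1, (X 1 ^ p2 : MvPolynomial (Fin 2) ℂ)] P2)) :
    (aeval ![X 0 ^ p1, (X 1 ^ p2 : MvPolynomial (Fin 2) ℂ)] P1).totalDegree = p1 * d1 := by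
  obtain ⟨hle, -, hzero, hlt⟩ := hreg
  have hge := weight_le_totalDegree hp1 hp2 (mem_support_iff.mpr hstable)
  simp only [Finsupp.single_eq_same, Finsupp.single_apply, zero_ne_one, if_false, mul_zero,
    add_zero] at hge
  refine le_antisymm ?_ hge
  rcases hle.lt_or_eq with h | h
  · obtain ⟨s, hs, hst⟩ := exists_dilate_eq_of_coeff_ne_zero (hlt h)
    have h0 := DFunLike.congr_fun hst 0
    rw [dilate_zero, Finsupp.single_eq_same] at h0
    rw [← h0]
    have := add_le_of_totalDegree_le hd1 hs
    exact Nat.mul_le_mul_left _ (by omega)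
  · by_contra! hgt
    have key : ∀ P : MvPolynomial (Fin 2) ℂ, P.totalDegree ≤ d1 → ∀ N, p1 * d1 < N →
        eval ![1, 0] (homogeneousComponent N
          (aeval ![X 0 ^ p1, (X 1 ^ p2 : MvPolynomial (Fin 2) ℂ)] P)) = 0 := by
      intro P hP N hN
      rw [eval_homogeneousComponent_aeval_pow]
      refine Finset.sum_eq_zero fun s hs => ?_
      obtain ⟨hs, hw⟩ := Finset.mem_filter.mp hs
      have hs1 : s 1 ≠ 0 := by
        intro hs1
        have := add_le_of_totalDegree_le hP hs
        have : p1 * s 0 ≤ p1 * d1 := Nat.mul_le_mul_left _ (by omega)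
        rw [hs1] at hw
        omega
      simp [hp2.ne', hs1]
    have hmem := (Set.ext_iff.mp hzero ![1, 0]).mp ⟨key P1 hd1 _ hgt, key P2 hd2 _ (h ▸ hgt)⟩
    simpa using congrFun (Set.mem_singleton_iff.mp hmem) 0

/-- (Proposition 3.1, necessity.) Let `f = (P₁,P₂)` be
algebraically stable with `deg P₁ = d₁ > deg P₂ = d₂ ≥ 1`. If `f` is `π`-regular for
some `π(z) = (z₁^{p₁}, z₂^{p₂})` with `p₁ ≤ p₂`, then the slope `σ` is negative and
the truncations `P₁^{D₁}`, `P₂^{D₂}` have no common zero but `0`. -/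
theorem stmt11 (P1 P2 : MvPolynomial (Fin 2) ℂ) (hP2 : P2 ≠ 0)
    (d1 d2 : ℕ) (hd1 : P1.totalDegree = d1) (hd2 : P2.totalDegree = d2)
    (hdd : d2 < d1) (hd21 : 1 ≤ d2)
    (hstable : coeff (Finsupp.single (0 : Fin 2) d1) P1 ≠ 0)
    (p1 p2 : ℕ) (hp1 : 0 < p1) (hp2 : 0 < p2) (hple : p1 ≤ p2)
    (π : Fin 2 → MvPolynomial (Fin 2) ℂ)
    (hπ : π = ![X 0 ^ p1, X 1 ^ p2])
    (hregular : Regular2 (aeval π P1) (aeval π P2)) :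
    slopeSigma P1 P2 d1 < 0 ∧
    {z : Fin 2 → ℂ |
        eval z (lineTrunc P1 (slopeSigma P1 P2 d1) (-(slopeSigma P1 P2 d1) * (d1 : ℝ))) = 0 ∧
        eval z (lineTrunc P2 (slopeSigma P1 P2 d1) (bD2 P2 (slopeSigma P1 P2 d1))) = 0}
      = {0} := by
  subst hπ
  set Q1 := aeval ![X 0 ^ p1, (X 1 ^ p2 : MvPolynomial (Fin 2) ℂ)] P1
  set Q2 := aeval ![X 0 ^ p1, (X 1 ^ p2 : MvPolynomial (Fin 2) ℂ)] P2
  have hN1 : Q1.totalDegree = p1 * d1 :=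
    totalDegree_aeval_pow_eq hd1.le (hd2 ▸ hdd.le) hstable hp1 hp2 hregular
  obtain ⟨hle, hQ2pos, hzero, -⟩ := hregular
  set σ := slopeSigma P1 P2 d1
  have hp1' : (0 : ℝ) < p1 := by exact_mod_cast hp1
  have hp2' : (0 : ℝ) < p2 := by exact_mod_cast hp2
  have hd1' : (0 : ℝ) < d1 := by exact_mod_cast (by omega : 0 < d1)
  have hlt : ∀ s : Fin 2 →₀ ℕ, (s ∈ P1.support ∨ s ∈ P2.support) → ¬(s 0 = d1 ∧ s 1 = 0) →
      (s 0 : ℝ) - d1 < 0 := by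
    intro s hs hne
    have : s 0 + s 1 ≤ d1 := hs.elim (add_le_of_totalDegree_le hd1.le)
      (add_le_of_totalDegree_le (hd2 ▸ hdd.le))
    have : s 0 < d1 := by omega
    rw [sub_neg]
    exact_mod_cast this
  have hweight : ∀ s : Fin 2 →₀ ℕ, (s ∈ P1.support ∨ s ∈ P2.support) →
      (p1 : ℝ) * s 0 + p2 * s 1 ≤ p1 * d1 := by
    intro s hs
    have : p1 * s 0 + p2 * s 1 ≤ p1 * d1 := hs.elim
      (fun h => (weight_le_totalDegree hp1 hp2 h).trans hN1.le)
      (fun h => (weight_le_totalDegree hp1 hp2 h).trans (hle.trans hN1.le))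
    exact_mod_cast this
  have hlower : ∀ x ∈ {x : ℝ | ∃ s : Fin 2 →₀ ℕ, (s ∈ P1.support ∨ s ∈ P2.support) ∧
      ¬(s 0 = d1 ∧ s 1 = 0) ∧ x = (s 1 : ℝ) / ((s 0 : ℝ) - (d1 : ℝ))},
      -(p1 / p2 : ℝ) ≤ x := by
    rintro _ ⟨s, hs, hne, rfl⟩
    rw [le_div_iff_of_neg (hlt s hs hne), neg_mul, ← sub_nonneg]
    have h := hweight s hs
    have : -(p1 / p2 * ((s 0 : ℝ) - d1)) - s 1 = (p1 * d1 - (p1 * s 0 + p2 * s 1)) / p2 := by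
      field_simp
      ring
    rw [this]
    exact div_nonneg (by linarith) hp2'.le
  have hσle : ∀ s : Fin 2 →₀ ℕ, (s ∈ P1.support ∨ s ∈ P2.support) → ¬(s 0 = d1 ∧ s 1 = 0) →
      σ ≤ (s 1 : ℝ) / ((s 0 : ℝ) - (d1 : ℝ)) := fun s hs hne =>
    csInf_le ⟨_, hlower⟩ ⟨s, hs, hne, rfl⟩
  obtain ⟨s₂, hs₂, hws₂⟩ := exists_weight_eq_totalDegree hP2 hp1 hp2
  have hs₂ne : ¬(s₂ 0 = d1 ∧ s₂ 1 = 0) := by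
    have := add_le_of_totalDegree_le hd2.le hs₂
    omega
  have hσge : -(p1 / p2 : ℝ) ≤ σ := le_csInf ⟨_, s₂, Or.inr hs₂, hs₂ne, rfl⟩ hlower
  rcases hσge.eq_or_lt with heq | hgt
  · have hb : bD2 P2 σ = (Q2.totalDegree : ℝ) / p2 := by
      refine bD2_eq (fun s hs => ?_) hs₂ ?_
      · have h : ((p1 * s 0 + p2 * s 1 : ℕ) : ℝ) ≤ Q2.totalDegree := by
          exact_mod_cast weight_le_totalDegree hp1 hp2 hs
        push_cast at h
        rw [← heq, le_div_iff₀ hp2']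
        field_simp
        linarith
      · rw [← hws₂, ← heq]
        push_cast
        field_simp
        ring
    have hb1 : -σ * d1 = (Q1.totalDegree : ℝ) / p2 := by
      rw [hN1, ← heq]
      push_cast
      ring
    refine ⟨heq ▸ neg_neg_of_pos (div_pos hp1' hp2'), ?_⟩
    ext z
    obtain ⟨u, hu⟩ := IsAlgClosed.exists_pow_nat_eq (z 0) hp1
    obtain ⟨v, hv⟩ := IsAlgClosed.exists_pow_nat_eq (z 1) hp2
    have hmem := Set.ext_iff.mp hzero ![u, v]
    rw [Set.mem_ofPred_eq,
      eval_lineTrunc_eq_eval_homogeneousComponent P1 hp2 heq.symm hb1 ![u, v] z hu hv,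
      eval_lineTrunc_eq_eval_homogeneousComponent P2 hp2 heq.symm hb ![u, v] z hu hv]
    refine hmem.trans ?_
    simp only [Set.mem_singleton_iff, funext_iff, Fin.forall_fin_two]
    simp [← hu, ← hv, hp1.ne', hp2.ne']
  · have hvertex : ∀ s ∈ P1.support, p1 * s 0 + p2 * s 1 = p1 * d1 → s 0 = d1 ∧ s 1 = 0 := by
      intro s hs hw
      by_contra hne
      have h := hgt.trans_le (hσle s (Or.inl hs) hne)
      rw [lt_div_iff_of_neg (hlt s (Or.inl hs) hne)] at h
      have hw' : (p1 : ℝ) * s 0 + p2 * s 1 = p1 * d1 := by exact_mod_cast hw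
      have : (s 1 : ℝ) = -(p1 / p2) * (s 0 - d1) := by
        field_simp
        linarith
      linarith
    have htop1 : eval ![0, 1] (homogeneousComponent Q1.totalDegree Q1) = 0 := by
      rw [eval_homogeneousComponent_aeval_pow, hN1]
      refine Finset.sum_eq_zero fun s hs => ?_
      obtain ⟨hs, hw⟩ := Finset.mem_filter.mp hs
      have hs0 : s 0 ≠ 0 := by
        have := (hvertex s hs hw).1
        omega
      simp [hp1.ne', hs0]
    have htop2 : eval ![0, 1] (homogeneousComponent Q2.totalDegree Q2) ≠ 0 := by
      intro h
      have hmem := (Set.ext_iff.mp hzero ![0, 1]).mp ⟨htop1, h⟩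
      simpa using congrFun (Set.mem_singleton_iff.mp hmem) 1
    rw [eval_homogeneousComponent_aeval_pow] at htop2
    obtain ⟨t, ht, htne⟩ := Finset.exists_ne_zero_of_sum_ne_zero htop2
    obtain ⟨ht, hwt⟩ := Finset.mem_filter.mp ht
    have ht0 : t 0 = 0 := by
      by_contra h
      simp [hp1.ne', h] at htne
    rw [ht0, mul_zero, zero_add] at hwt
    have ht1 : 0 < t 1 := by
      rcases Nat.eq_zero_or_pos (t 1) with h | h
      · rw [h] at hwt
        omega
      · exact h
    have ht1' : (0 : ℝ) < t 1 := by exact_mod_cast ht1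
    have hσneg : σ < 0 := by
      refine (hσle t (Or.inr ht) (by omega)).trans_lt ?_
      rw [ht0]
      exact div_neg_of_pos_of_neg ht1' (by simpa using hd1')
    have hbound : ∀ s ∈ P2.support, (s 1 : ℝ) + p1 / p2 * s 0 ≤ t 1 := by
      intro s hs
      have h : ((p1 * s 0 + p2 * s 1 : ℕ) : ℝ) ≤ ((p2 * t 1 : ℕ) : ℝ) := by
        exact_mod_cast hwt ▸ weight_le_totalDegree hp1 hp2 hs
      push_cast at h
      rw [← mul_le_mul_iff_right₀ hp2']
      field_simp
      linarith
    have hb : bD2 P2 σ = t 1 := by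
      refine bD2_eq (fun s hs => ?_) ht (by simp [ht0])
      have h0 : (0 : ℝ) ≤ s 0 := Nat.cast_nonneg _
      nlinarith [hbound s hs]
    have hfilter2 : P2.support.filter (fun s => (s 1 : ℝ) - σ * (s 0 : ℝ) = t 1) = {t} := by
      ext s
      rw [Finset.mem_filter, Finset.mem_singleton]
      constructor
      · rintro ⟨hs, hline⟩
        have hs0 : s 0 = 0 := by
          by_contra h
          have h0 : (0 : ℝ) < s 0 := by exact_mod_cast Nat.pos_of_ne_zero h
          nlinarith [hbound s hs]
        rw [hs0, Nat.cast_zero, mul_zero, sub_zero, Nat.cast_inj] at hline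
        rw [fin_two_ext hs0 hline, ← fin_two_ext ht0 rfl]
      · rintro rfl
        exact ⟨ht, by simp [ht0]⟩
    have heval2 : ∀ z : Fin 2 → ℂ,
        eval z (lineTrunc P2 σ (bD2 P2 σ)) = coeff t P2 * z 1 ^ t 1 := by
      intro z
      rw [hb, eval_lineTrunc, hfilter2, Finset.sum_singleton, ht0, pow_zero, one_mul]
    have heval1 : ∀ z : Fin 2 → ℂ, z 1 = 0 →
        eval z (lineTrunc P1 σ (-σ * d1)) =
          coeff (Finsupp.single (0 : Fin 2) d1) P1 * z 0 ^ d1 := by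
      intro z hz
      rw [eval_lineTrunc, Finset.sum_eq_single (Finsupp.single (0 : Fin 2) d1)]
      · simp
      · intro s hs hne
        obtain ⟨-, hline⟩ := Finset.mem_filter.mp hs
        have hs1 : s 1 ≠ 0 := by
          intro hs1
          rw [hs1, Nat.cast_zero, zero_sub, ← neg_mul] at hline
          have hs0 : s 0 = d1 := by
            exact_mod_cast mul_left_cancel₀ (neg_ne_zero.mpr hσneg.ne) hline
          exact hne (by rw [fin_two_ext hs0 hs1, Finsupp.single_zero, add_zero])
        simp [hz, hs1]
      · intro h
        exact absurd (Finset.mem_filter.mpr ⟨mem_support_iff.mpr hstable, by simp⟩) h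
    refine ⟨hσneg, ?_⟩
    ext z
    rw [Set.mem_ofPred_eq, Set.mem_singleton_iff, heval2]
    constructor
    · rintro ⟨h1, h2⟩
      have hz1 : z 1 = 0 := eq_zero_of_pow_eq_zero
        ((mul_eq_zero.mp h2).resolve_left (mem_support_iff.mp ht))
      rw [heval1 z hz1] at h1
      have hz0 : z 0 = 0 := eq_zero_of_pow_eq_zero
        ((mul_eq_zero.mp h1).resolve_left hstable)
      ext i
      fin_cases i
      · exact hz0
      · exact hz1
    · rintro rfl
      rw [heval1 0 rfl]
      have hd1ne : d1 ≠ 0 := by omega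
      simp [ht1.ne', hd1ne]
end
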